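/- Let 1<p<∞, 1<q≤∞, 0<β<1, and Λ≥2, and assume μ satisfies the quantitative reverse doubling condition for some exponent σ>βp. Let B⊂X be a ball and let E⊂closure(B) be a compact set. Then there exists a constant C=C(c_σ,p,q,σ,β,c_μ,Λ)>0 such that cap^β_{p,q}(E,2B,ΛB) ≤ C·R_{β,p}(E). -/

import Mathlib

open MeasureTheory Metric Set
open scoped ENNReal NNReal

noncomputable section

namespace TLCap

variable {X : Type*} [MetricSpace X] [MeasurableSpace X] [BorelSpace X]

/-- `validIdx X n` means `n ≥ n₀`, i.e. `2^{-n} ≤ 2 diam X`;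
all `n : ℤ` are valid when `X` is unbounded. -/
def validIdx (X : Type*) [PseudoMetricSpace X] (n : ℤ) : Prop :=
  ENNReal.ofReal ((2 : ℝ) ^ (-n)) ≤ 2 * EMetric.diam (Set.univ : Set X)

/-- The doubling condition for `μ`, with doubling constant `c`. -/
def IsDoubling (μ : Measure X) (c : ℝ≥0∞) : Prop :=
  ∀ (x : X) (r : ℝ), 0 < r → μ (ball x (2 * r)) ≤ c * μ (ball x r)

/-- The reverse doubling condition with constant `c`. -/
def IsReverseDoubling (μ : Measure X) (c : ℝ≥0∞) : Prop :=
  ∀ (x : X) (r : ℝ), 0 < r → 2 * ENNReal.ofReal r < EMetric.diam (Set.univ : Set X) →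
    μ (ball x (r / 2)) ≤ c * μ (ball x r)

/-- The quantitative reverse doubling condition with exponent `σ` and constant `c`. -/
def IsQRD (μ : Measure X) (σ : ℝ) (c : ℝ≥0∞) : Prop :=
  ∀ (x : X) (r R : ℝ), 0 < r → r < R →
    ENNReal.ofReal R ≤ 2 * EMetric.diam (Set.univ : Set X) →
    μ (ball x r) ≤ c * ENNReal.ofReal ((r / R) ^ σ) * μ (ball x R)

open Classical in
/-- The `l^q` norm of a sequence of extended nonnegative reals (`q = ∞` allowed). -/
def lqNorm (q : ℝ≥0∞) (a : ℤ → ℝ≥0∞) : ℝ≥0∞ :=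
  if q = ∞ then ⨆ k, a k else (∑' k, a k ^ q.toReal) ^ (1 / q.toReal)

/-- The mixed norm `‖g‖_{L^p(Ω; l^q)}`. -/
def mixedNorm (μ : Measure X) (Ω : Set X) (p : ℝ) (q : ℝ≥0∞) (g : ℤ → X → ℝ≥0∞) : ℝ≥0∞ :=
  (∫⁻ x in Ω, lqNorm q (fun k => g k x) ^ p ∂μ) ^ (1 / p)

/-- `g = (g_k)_{k ∈ ℤ}` is a fractional `β`-Hajłasz gradient of `u` on `Ω`. -/
def IsFracGrad (μ : Measure X) (β : ℝ) (Ω : Set X) (u : X → ℝ) (g : ℤ → X → ℝ≥0∞) : Prop :=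
  (∀ k, Measurable (g k)) ∧
  ∃ N : Set X, N ⊆ Ω ∧ μ N = 0 ∧
    ∀ (k : ℤ), ∀ x ∈ Ω \ N, ∀ y ∈ Ω \ N,
      (2 : ℝ) ^ (-k - 1) ≤ dist x y → dist x y < (2 : ℝ) ^ (-k) →
      ENNReal.ofReal |u x - u y| ≤ ENNReal.ofReal (dist x y ^ β) * (g k x + g k y)

/-- The homogeneous Hajłasz–Triebel–Lizorkin seminorm `|u|_{Ṁ^β_{p,q}(Ω)}`. -/
def htlSeminorm (μ : Measure X) (β p : ℝ) (q : ℝ≥0∞) (Ω : Set X) (u : X → ℝ) : ℝ≥0∞ :=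
  ⨅ g : {g : ℤ → X → ℝ≥0∞ // IsFracGrad μ β Ω u g}, mixedNorm μ Ω p q g.1

/-- The relative Hajłasz–Triebel–Lizorkin capacity `cap^β_{p,q}(E, 2B, ΛB)`,
where `B = B(x₀, r)`. -/
def relCap (μ : Measure X) (β p : ℝ) (q : ℝ≥0∞) (E : Set X) (x₀ : X) (r Λ : ℝ) : ℝ≥0∞ :=
  ⨅ φ : {φ : X → ℝ // Continuous φ ∧ (∀ x ∈ E, 1 ≤ φ x) ∧ ∀ x ∉ ball x₀ (2 * r), φ x = 0},
    htlSeminorm μ β p q (ball x₀ (Λ * r)) φ.1 ^ p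

open Classical in
/-- The potential `H_β f`. -/
def Hpot (μ : Measure X) (β : ℝ) (f : ℤ → X → ℝ≥0∞) (x : X) : ℝ≥0∞ :=
  ∑' n : ℤ, if validIdx X n then
    (2 : ℝ≥0∞) ^ (-β * (n : ℝ)) *
      ∫⁻ y, (ball y ((2 : ℝ) ^ (-n))).indicator (fun _ => (1 : ℝ≥0∞)) x * f n y /
        μ (ball y ((2 : ℝ) ^ (-n))) ∂μ
  else 0

/-- A sequence `(f_n)_{n ≥ n₀}` of nonnegative Borel functions, realized as a sequence
indexed by `ℤ` vanishing at invalid indices. -/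
def IsAdmissibleSeq (f : ℤ → X → ℝ≥0∞) : Prop :=
  (∀ n, Measurable (f n)) ∧ ∀ n, ¬ validIdx X n → f n = 0

/-- The Triebel–Lizorkin `(β,p,q)`-capacity `Cp^β_{p,q}(E)`. -/
def CpCap (μ : Measure X) (β p : ℝ) (q : ℝ≥0∞) (E : Set X) : ℝ≥0∞ :=
  ⨅ f : {f : ℤ → X → ℝ≥0∞ // IsAdmissibleSeq f ∧ ∀ x ∈ E, 1 ≤ Hpot μ β f x},
    mixedNorm μ Set.univ p q f.1 ^ p

open Classical in
/-- The sequence `Ȟ_β ν`. -/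
def Hcheck (μ ν : Measure X) (β : ℝ) : ℤ → X → ℝ≥0∞ := fun n x =>
  if validIdx X n then
    (2 : ℝ≥0∞) ^ (-β * (n : ℝ)) * ν (ball x ((2 : ℝ) ^ (-n))) / μ (ball x ((2 : ℝ) ^ (-n)))
  else 0

/-- `ν` is a nonnegative Radon measure on the (compact) set `E`. -/
def IsRadonOn (ν : Measure X) (E : Set X) : Prop :=
  ν Eᶜ = 0 ∧ ν E ≠ ∞ ∧
  (∀ F : Set X, MeasurableSet F → F ⊆ E →
    ν F = ⨅ (U : Set X) (_ : IsOpen U) (_ : F ⊆ U ∩ E), ν (U ∩ E)) ∧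
  (∀ F : Set X, MeasurableSet F → F ⊆ E →
    ν F = ⨆ (K : Set X) (_ : IsCompact K) (_ : K ⊆ F), ν K)

open Classical in
/-- The conjugate exponent, with `1' = ∞` and `∞' = 1`. -/
def conjExp (q : ℝ≥0∞) : ℝ≥0∞ :=
  if q = 1 then ∞ else if q = ∞ then 1 else ENNReal.ofReal (q.toReal / (q.toReal - 1))

/-- `2^{-n₀}` (equal to `∞` when `X` is unbounded). -/
def radMax (X : Type*) [PseudoMetricSpace X] : ℝ≥0∞ :=
  ⨆ (n : ℤ) (_ : validIdx X n), ENNReal.ofReal ((2 : ℝ) ^ (-n))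

/-- The fractional maximal function `M_β ν`. -/
def fracMax (μ ν : Measure X) (β : ℝ) (x : X) : ℝ≥0∞ :=
  ⨆ (r : ℝ) (_ : 0 < r) (_ : ENNReal.ofReal r ≤ radMax X),
    ENNReal.ofReal (r ^ β) * ν (ball x r) / μ (ball x r)

/-- The Riesz potential `I_β ν` of a nonnegative Borel measure. -/
def rieszPot (μ ν : Measure X) (β : ℝ) (x : X) : ℝ≥0∞ :=
  ∫⁻ y in {x}ᶜ, ENNReal.ofReal (dist x y ^ β) / μ (ball x (dist x y)) ∂ν

/-- The Riesz `(β,p)`-capacity `R_{β,p}(E)`. -/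
def rieszCap (μ : Measure X) (β p : ℝ) (E : Set X) : ℝ≥0∞ :=
  ⨅ f : {f : X → ℝ≥0∞ // Measurable f ∧ ∀ x ∈ E, 1 ≤ rieszPot μ (μ.withDensity f) β x},
    ∫⁻ x, f.1 x ^ p ∂μ

/-- The `ρ`-restricted Hausdorff content of codimension `d`. -/
def hContent (μ : Measure X) (d : ℝ) (ρ : ℝ≥0∞) (F : Set X) : ℝ≥0∞ :=
  ⨅ c : {c : ℕ → X × ℝ //
      (∀ k, 0 < (c k).2 ∧ ENNReal.ofReal (c k).2 ≤ ρ) ∧ F ⊆ ⋃ k, ball (c k).1 (c k).2},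
    ∑' k, μ (ball (c.1 k).1 (c.1 k).2) * ENNReal.ofReal ((c.1 k).2 ^ (-d))

/-- Partition of unity data at every valid scale: the balls `B(x_{n,i}, 2^{-n-1})` are pairwise
disjoint, the balls `B(x_{n,i}, 2^{-n})` cover `X`, and `ψ_{n,i}` is the associated
partition of unity with constants `κ` and `L`. -/
def IsPartition {ι : ℤ → Type*} (pt : ∀ n, ι n → X)
    (ψ : ∀ n, ι n → X → ℝ) (κ L : ℝ) : Prop :=
  ∀ n : ℤ, validIdx X n →
    (∀ i j : ι n, i ≠ j →
        Disjoint (ball (pt n i) ((2:ℝ) ^ (-n - 1))) (ball (pt n j) ((2:ℝ) ^ (-n - 1)))) ∧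
    (∀ x : X, ∃ i : ι n, x ∈ ball (pt n i) ((2:ℝ) ^ (-n))) ∧
    (∀ (i : ι n) (x : X), 0 ≤ ψ n i x ∧ ψ n i x ≤ 1) ∧
    (∀ (i : ι n), ∀ x ∉ ball (pt n i) (6 * (2:ℝ) ^ (-n)), ψ n i x = 0) ∧
    (∀ (i : ι n), ∀ x ∈ ball (pt n i) (3 * (2:ℝ) ^ (-n)), κ ≤ ψ n i x) ∧
    (∀ i : ι n, LipschitzWith (Real.toNNReal ((2:ℝ) ^ n * L)) (ψ n i)) ∧
    (∀ x : X, HasSum (fun i : ι n => ψ n i x) 1)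

open Classical in
/-- The discrete potential `L_β f`. -/
def discPot {ι : ℤ → Type*} (μ : Measure X) (β : ℝ) (pt : ∀ n, ι n → X)
    (ψ : ∀ n, ι n → X → ℝ) (f : ℤ → X → ℝ≥0∞) (x : X) : ℝ≥0∞ :=
  ∑' n : ℤ, if validIdx X n then
    (2 : ℝ≥0∞) ^ (-β * (n : ℝ)) *
      ∑' i : ι n, ENNReal.ofReal (ψ n i x) *
        ((∫⁻ y in ball (pt n i) (3 * (2:ℝ) ^ (-n)), f n y ∂μ) /
          μ (ball (pt n i) (3 * (2:ℝ) ^ (-n))))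
  else 0

/-- A geodesic metric space: any two points are joined by an isometric image of an interval. -/
def IsGeodesicSpace (X : Type*) [MetricSpace X] : Prop :=
  ∀ x y : X, ∃ γ : ℝ → X, γ 0 = x ∧ γ (dist x y) = y ∧
    ∀ s ∈ Set.Icc (0:ℝ) (dist x y), ∀ t ∈ Set.Icc (0:ℝ) (dist x y),
      dist (γ s) (γ t) = |s - t|

/-- The Hajłasz–Triebel–Lizorkin `(β,p,q)`-capacity density condition with
constants `c₀, c₁, Λ`. -/
def HTLDensity (μ : Measure X) (β p : ℝ) (q : ℝ≥0∞) (E : Set X) (c₀ c₁ Λ : ℝ) : Prop :=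
  ∀ x ∈ E, ∀ r : ℝ, 0 < r → ENNReal.ofReal r < ENNReal.ofReal c₁ * EMetric.diam E →
    ENNReal.ofReal c₀ * relCap μ β p q (closure (ball x r)) x r Λ ≤
      relCap μ β p q (E ∩ closure (ball x r)) x r Λ

/-- The Riesz `(β,p)`-capacity density condition with constant `c₀`. -/
def RieszDensity (μ : Measure X) (β p : ℝ) (E : Set X) (c₀ : ℝ) : Prop :=
  ∀ x ∈ E, ∀ r : ℝ, 0 < r → ENNReal.ofReal (8 * r) < EMetric.diam E →
    ENNReal.ofReal c₀ * rieszCap μ β p (closure (ball x r)) ≤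
      rieszCap μ β p (E ∩ closure (ball x r))

/-- The Hausdorff content density condition of codimension `d` with constant `c₀`. -/
def HausdorffDensity (μ : Measure X) (d : ℝ) (E : Set X) (c₀ : ℝ) : Prop :=
  ∀ x ∈ E, ∀ r : ℝ, 0 < r → ENNReal.ofReal r < EMetric.diam E →
    ENNReal.ofReal c₀ * hContent μ d (ENNReal.ofReal r) (closure (ball x r)) ≤
      hContent μ d (ENNReal.ofReal r) (E ∩ closure (ball x r))


set_option linter.unusedSectionVars false

/-! ### Dyadic sums of extended nonnegative reals -/

/-- The constant in the geometric sum `∑_{2 ^ j < x} 2 ^ {js} ≤ dyadicConst s * x ^ s`. -/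
def dyadicConst (s : ℝ) : ℝ≥0∞ := (1 - (2 : ℝ≥0∞) ^ (-s))⁻¹

lemma two_rpow_neg_lt_one {s : ℝ} (hs : 0 < s) : (2 : ℝ≥0∞) ^ (-s) < 1 :=
  ENNReal.rpow_lt_one_of_one_lt_of_neg (by norm_num) (by linarith)

lemma dyadicConst_ne_zero (s : ℝ) : dyadicConst s ≠ 0 := by
  refine ENNReal.inv_ne_zero.2 (ne_of_lt ?_)
  exact lt_of_le_of_lt tsub_le_self ENNReal.one_lt_top

lemma dyadicConst_ne_top {s : ℝ} (hs : 0 < s) : dyadicConst s ≠ ∞ :=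
  ENNReal.inv_ne_top.2 (tsub_pos_of_lt (two_rpow_neg_lt_one hs)).ne'

open Classical in
lemma tsum_zpow_rpow_lt_le {s : ℝ} (hs : 0 < s) (x : ℝ≥0∞) :
    ∑' j : ℤ, (if (2 : ℝ≥0∞) ^ j < x then ((2 : ℝ≥0∞) ^ j) ^ s else 0) ≤
      dyadicConst s * x ^ s := by
  rcases eq_or_ne x 0 with rfl | hx0
  · simp
  rcases eq_or_ne x ∞ with rfl | hxt
  · rw [ENNReal.top_rpow_of_pos hs, ENNReal.mul_top (dyadicConst_ne_zero s)]
    exact le_top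
  obtain ⟨n, hn1, hn2⟩ := ENNReal.exists_mem_Ioc_zpow hx0 hxt ENNReal.one_lt_two ENNReal.ofNat_ne_top
  have hle : ∀ j : ℤ, (2 : ℝ≥0∞) ^ j < x → j ≤ n := by
    intro j hj
    by_contra! h
    have : (2 : ℝ≥0∞) ^ (n + 1) ≤ 2 ^ j := ENNReal.zpow_le_of_le one_le_two (by omega)
    exact absurd (hj.trans_le (hn2.trans this)) (lt_irrefl _)
  have hinj : Function.Injective (fun i : ℕ => n - (i : ℤ)) := by
    intro a b h
    simp only [] at h
    omega
  have hsupp : Function.support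
      (fun j : ℤ => if (2 : ℝ≥0∞) ^ j < x then ((2 : ℝ≥0∞) ^ j) ^ s else 0) ⊆
      Set.range (fun i : ℕ => n - (i : ℤ)) := by
    intro j hj
    have hj' : (2 : ℝ≥0∞) ^ j < x := by
      by_contra h
      simp [h] at hj
    exact ⟨(n - j).toNat, by have := hle j hj'; simp only []; omega⟩
  rw [← hinj.tsum_eq hsupp]
  have hterm : ∀ i : ℕ, (if (2 : ℝ≥0∞) ^ (n - (i : ℤ)) < x then
      ((2 : ℝ≥0∞) ^ (n - (i : ℤ))) ^ s else 0) ≤ x ^ s * ((2 : ℝ≥0∞) ^ (-s)) ^ i := by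
    intro i
    split_ifs
    · have e : (2 : ℝ≥0∞) ^ (n - (i : ℤ)) = 2 ^ n * ((2 : ℝ≥0∞) ^ (i : ℝ))⁻¹ := by
        rw [sub_eq_add_neg, ENNReal.zpow_add (by norm_num) (by norm_num), ENNReal.zpow_neg]
        norm_cast
      rw [e, ENNReal.mul_rpow_of_nonneg _ _ hs.le, ENNReal.inv_rpow, ← ENNReal.rpow_mul,
        ← ENNReal.rpow_natCast, ← ENNReal.rpow_mul, ← ENNReal.rpow_neg,
        show -s * (i : ℝ) = -((i : ℝ) * s) by ring]
      gcongr
    · exact zero_le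
  refine (ENNReal.tsum_le_tsum hterm).trans ?_
  rw [ENNReal.tsum_mul_left, ENNReal.tsum_geometric, mul_comm]
  rfl

open Classical in
lemma rpow_le_tsum_zpow_rpow_lt {p : ℝ} (hp : 0 < p) (x : ℝ≥0∞) :
    x ^ p ≤ 2 ^ p * ∑' j : ℤ, (if (2 : ℝ≥0∞) ^ j < x then ((2 : ℝ≥0∞) ^ j) ^ p else 0) := by
  rcases eq_or_ne x 0 with rfl | hx0
  · simp [hp]
  rcases eq_or_ne x ∞ with rfl | hxt
  · have h1 : ∑' j : ℕ, (1 : ℝ≥0∞) ≤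
        ∑' j : ℤ, (if (2 : ℝ≥0∞) ^ j < ∞ then ((2 : ℝ≥0∞) ^ j) ^ p else 0) := by
      refine le_trans ?_ (ENNReal.tsum_comp_le_tsum_of_injective
        (f := fun j : ℕ => (j : ℤ)) Nat.cast_injective _)
      refine ENNReal.tsum_le_tsum fun j => ?_
      rw [if_pos (by simp)]
      refine ENNReal.one_le_rpow ?_ hp
      rw [zpow_natCast]
      exact one_le_pow₀ one_le_two
    rw [ENNReal.tsum_const_eq_top_of_ne_zero one_ne_zero, top_le_iff] at h1
    rw [h1, ENNReal.mul_top]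
    · exact le_top
    · simp
  obtain ⟨n, hn1, hn2⟩ := ENNReal.exists_mem_Ioc_zpow hx0 hxt ENNReal.one_lt_two ENNReal.ofNat_ne_top
  calc x ^ p ≤ ((2 : ℝ≥0∞) ^ (n + 1)) ^ p := by gcongr
    _ = 2 ^ p * (if (2 : ℝ≥0∞) ^ n < x then ((2 : ℝ≥0∞) ^ n) ^ p else 0) := by
        rw [if_pos hn1, ← ENNReal.mul_rpow_of_nonneg _ _ hp.le,
          ENNReal.zpow_add (by norm_num) (by norm_num), zpow_one, mul_comm]
    _ ≤ _ := by
        gcongr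
        exact ENNReal.le_tsum n

/-- Summing `(2 ^ (k + 1)) ^ β * min 1 (2 ^ (-k) / s)` over all dyadic scales gives a multiple
of `s ^ (-β)`. -/
lemma exists_tsum_scale_le {β : ℝ} (h0 : 0 < β) (h1 : β < 1) :
    ∃ C : ℝ≥0∞, C ≠ ∞ ∧ ∀ s : ℝ, 0 < s →
      ∑' k : ℤ, ENNReal.ofReal (s ^ β) * ENNReal.ofReal (((2 : ℝ) ^ (k + 1)) ^ β *
        min 1 ((2 : ℝ) ^ (-k) / s)) ≤ C := by
  classical
  have zr : ∀ k : ℤ, ENNReal.ofReal ((2 : ℝ) ^ k) = (2 : ℝ≥0∞) ^ k := by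
    intro k
    rw [← Real.rpow_intCast, ← ENNReal.ofReal_rpow_of_pos two_pos, ENNReal.rpow_intCast]
    simp
  refine ⟨2 ^ β * dyadicConst β + 2 * dyadicConst (1 - β), ?_, ?_⟩
  · have a1 := dyadicConst_ne_top h0
    have a2 := dyadicConst_ne_top (s := 1 - β) (by linarith)
    have a3 : (2 : ℝ≥0∞) ^ β ≠ ∞ := ENNReal.rpow_ne_top_of_nonneg h0.le (by norm_num)
    finiteness
  intro s hs
  have key : ∀ k : ℤ, ENNReal.ofReal (s ^ β) * ENNReal.ofReal (((2 : ℝ) ^ (k + 1)) ^ β *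
        min 1 ((2 : ℝ) ^ (-k) / s)) ≤
      2 ^ β * ENNReal.ofReal (s ^ β) * (if (2 : ℝ≥0∞) ^ k < ENNReal.ofReal (s⁻¹) then
          ((2 : ℝ≥0∞) ^ k) ^ β else 0) +
      2 ^ β * ENNReal.ofReal (s ^ (β - 1)) *
        (if (2 : ℝ≥0∞) ^ (-k) < ENNReal.ofReal (2 * s) then
          ((2 : ℝ≥0∞) ^ (-k)) ^ (1 - β) else 0) := by
    intro k
    have hk : (0 : ℝ) < 2 ^ k := by positivity
    have e1 : ((2 : ℝ) ^ (k + 1)) ^ β = 2 ^ β * ((2 : ℝ) ^ k) ^ β := by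
      rw [zpow_add₀ (by norm_num), zpow_one, mul_comm,
        Real.mul_rpow (by norm_num) hk.le]
    have e2 : (2 : ℝ≥0∞) ^ β = ENNReal.ofReal ((2 : ℝ) ^ β) := by
      rw [← ENNReal.ofReal_rpow_of_pos two_pos]; simp
    rcases lt_or_ge ((2 : ℝ) ^ k) s⁻¹ with h | h
    · refine le_trans ?_ le_self_add
      have h' : (2 : ℝ≥0∞) ^ k < ENNReal.ofReal (s⁻¹) := by
        rw [← zr]; exact (ENNReal.ofReal_lt_ofReal_iff (by positivity)).2 h
      rw [if_pos h', ← zr, ENNReal.ofReal_rpow_of_pos hk, e2,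
        ← ENNReal.ofReal_mul (by positivity), ← ENNReal.ofReal_mul (by positivity),
        ← ENNReal.ofReal_mul (by positivity)]
      refine ENNReal.ofReal_le_ofReal ?_
      rw [e1]
      calc s ^ β * (2 ^ β * ((2 : ℝ) ^ k) ^ β * min 1 (2 ^ (-k) / s))
          ≤ s ^ β * (2 ^ β * ((2 : ℝ) ^ k) ^ β * 1) := by
            gcongr; exact min_le_left _ _
        _ = _ := by ring
    · refine le_trans ?_ le_add_self
      have hk' : (2 : ℝ) ^ (-k) ≤ s := by
        rw [zpow_neg]; exact inv_le_of_inv_le₀ hs h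
      have h' : (2 : ℝ≥0∞) ^ (-k) < ENNReal.ofReal (2 * s) := by
        rw [← zr]; exact (ENNReal.ofReal_lt_ofReal_iff (by positivity)).2 (by linarith)
      rw [if_pos h', ← zr, ENNReal.ofReal_rpow_of_pos (by positivity), e2,
        ← ENNReal.ofReal_mul (by positivity), ← ENNReal.ofReal_mul (by positivity),
        ← ENNReal.ofReal_mul (by positivity)]
      refine ENNReal.ofReal_le_ofReal ?_
      rw [e1]
      have e3 : ((2 : ℝ) ^ (-k)) ^ (1 - β) = (2 : ℝ) ^ (-k) * ((2 : ℝ) ^ k) ^ β := by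
        rw [Real.rpow_sub (by positivity), Real.rpow_one, zpow_neg, Real.inv_rpow hk.le,
          div_inv_eq_mul]
      have e4 : s ^ (β - 1) = s ^ β / s := by rw [Real.rpow_sub hs, Real.rpow_one]
      rw [e3, e4]
      calc s ^ β * (2 ^ β * ((2 : ℝ) ^ k) ^ β * min 1 (2 ^ (-k) / s))
          ≤ s ^ β * (2 ^ β * ((2 : ℝ) ^ k) ^ β * (2 ^ (-k) / s)) := by
            gcongr; exact min_le_right _ _
        _ = _ := by ring
  refine (ENNReal.tsum_le_tsum key).trans ?_
  rw [ENNReal.tsum_add, ENNReal.tsum_mul_left, ENNReal.tsum_mul_left]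
  refine add_le_add ?_ ?_
  · refine (mul_le_mul_right (tsum_zpow_rpow_lt_le h0 _) _).trans (le_of_eq ?_)
    rw [ENNReal.ofReal_rpow_of_pos (by positivity), Real.inv_rpow hs.le]
    have : ENNReal.ofReal (s ^ β) * ENNReal.ofReal (s ^ β)⁻¹ = 1 := by
      rw [← ENNReal.ofReal_mul (by positivity), mul_inv_cancel₀ (by positivity)]; simp
    calc _ = 2 ^ β * dyadicConst β * (ENNReal.ofReal (s ^ β) * ENNReal.ofReal (s ^ β)⁻¹) := by
          ring
      _ = _ := by rw [this, mul_one]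
  · have e : ∑' k : ℤ, (if (2 : ℝ≥0∞) ^ (-k) < ENNReal.ofReal (2 * s) then
          ((2 : ℝ≥0∞) ^ (-k)) ^ (1 - β) else 0) =
        ∑' k : ℤ, (if (2 : ℝ≥0∞) ^ k < ENNReal.ofReal (2 * s) then
          ((2 : ℝ≥0∞) ^ k) ^ (1 - β) else 0) :=
      (Equiv.neg ℤ).tsum_eq (fun k : ℤ => if (2 : ℝ≥0∞) ^ k < ENNReal.ofReal (2 * s) then
          ((2 : ℝ≥0∞) ^ k) ^ (1 - β) else 0)
    rw [e]
    refine (mul_le_mul_right (tsum_zpow_rpow_lt_le (by linarith) _) _).trans (le_of_eq ?_)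
    have e2 : (2 : ℝ≥0∞) ^ β = ENNReal.ofReal ((2 : ℝ) ^ β) := by
      rw [← ENNReal.ofReal_rpow_of_pos two_pos]; simp
    have : 2 ^ β * ENNReal.ofReal (s ^ (β - 1)) * ENNReal.ofReal (2 * s) ^ (1 - β) = 2 := by
      rw [ENNReal.ofReal_rpow_of_pos (by positivity), e2, ← ENNReal.ofReal_mul (by positivity),
        ← ENNReal.ofReal_mul (by positivity), Real.mul_rpow (by positivity) hs.le,
        show (2 : ℝ) ^ β * s ^ (β - 1) * (2 ^ (1 - β) * s ^ (1 - β)) =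
          (2 ^ β * 2 ^ (1 - β)) * (s ^ (β - 1) * s ^ (1 - β)) by ring,
        ← Real.rpow_add two_pos, ← Real.rpow_add hs]
      simp
    calc _ = 2 ^ β * ENNReal.ofReal (s ^ (β - 1)) * ENNReal.ofReal (2 * s) ^ (1 - β) *
          dyadicConst (1 - β) := by ring
      _ = _ := by rw [this]

/-! ### The Hardy–Littlewood maximal function -/

/-- The average of `F` over the ball `B(x, ρ)`. -/
def ballAvg (μ : Measure X) (F : X → ℝ≥0∞) (x : X) (ρ : ℝ) : ℝ≥0∞ :=
  (∫⁻ z in ball x ρ, F z ∂μ) / μ (ball x ρ)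

/-- The uncentered maximal function over balls of radius in `(0, R]`. -/
def maxFn (μ : Measure X) (R : ℝ) (F : X → ℝ≥0∞) (y : X) : ℝ≥0∞ :=
  ⨆ (b : {b : X × ℝ // (0 < b.2 ∧ b.2 ≤ R) ∧ y ∈ ball b.1 b.2}), ballAvg μ F b.1.1 b.1.2

lemma IsDoubling.measure_ball_pow_mul_le {μ : Measure X} {c : ℝ≥0∞} (h : IsDoubling μ c)
    (k : ℕ) (x : X) {ρ : ℝ} (hρ : 0 < ρ) : μ (ball x (2 ^ k * ρ)) ≤ c ^ k * μ (ball x ρ) := by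
  induction k with
  | zero => simp
  | succ k ih =>
    calc μ (ball x (2 ^ (k + 1) * ρ)) = μ (ball x (2 * (2 ^ k * ρ))) := by ring_nf
      _ ≤ c * μ (ball x (2 ^ k * ρ)) := h x _ (by positivity)
      _ ≤ c * (c ^ k * μ (ball x ρ)) := by gcongr
      _ = c ^ (k + 1) * μ (ball x ρ) := by ring

lemma sigmaFinite_of_measure_ball_ne_top {μ : Measure X} [Nonempty X]
    (hfin : ∀ (x : X) (r : ℝ), μ (ball x r) ≠ ∞) : SigmaFinite μ := by
  obtain ⟨x⟩ := ‹Nonempty X›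
  exact ⟨⟨{ set := fun n : ℕ => ball x n
            set_mem := fun _ => trivial
            finite := fun n => (hfin x n).lt_top
            spanning := iUnion_ball_nat x }⟩⟩

lemma ballAvg_le_maxFn {μ : Measure X} {F : X → ℝ≥0∞} {R ρ : ℝ} {w y : X} (h0 : 0 < ρ)
    (hR : ρ ≤ R) (hy : y ∈ ball w ρ) : ballAvg μ F w ρ ≤ maxFn μ R F y :=
  le_iSup (fun b : {b : X × ℝ // (0 < b.2 ∧ b.2 ≤ R) ∧ y ∈ ball b.1 b.2} =>
    ballAvg μ F b.1.1 b.1.2) ⟨(w, ρ), ⟨h0, hR⟩, hy⟩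

lemma setOf_lt_maxFn (μ : Measure X) (R : ℝ) (F : X → ℝ≥0∞) (t : ℝ≥0∞) :
    {y | t < maxFn μ R F y} =
      ⋃ b ∈ {b : X × ℝ | (0 < b.2 ∧ b.2 ≤ R) ∧ t < ballAvg μ F b.1 b.2}, ball b.1 b.2 := by
  ext y
  simp only [maxFn, mem_ofPred_eq, lt_iSup_iff, mem_iUnion, exists_prop]
  constructor
  · rintro ⟨⟨b, hb, hy⟩, h⟩
    exact ⟨b, ⟨hb, h⟩, hy⟩
  · rintro ⟨b, ⟨hb, h⟩, hy⟩
    exact ⟨⟨b, hb, hy⟩, h⟩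

lemma measurable_maxFn (μ : Measure X) (R : ℝ) (F : X → ℝ≥0∞) : Measurable (maxFn μ R F) := by
  refine measurable_of_Ioi fun t => ?_
  change MeasurableSet {y | t < maxFn μ R F y}
  rw [setOf_lt_maxFn]
  exact (isOpen_biUnion fun _ _ => isOpen_ball).measurableSet

/-- Vitali's covering argument: balls of bounded radius on each of which the average of `G` is at
least `t` have a union of measure at most `c ^ 3 * t⁻¹ * ∫ G`. -/
lemma mul_measure_biUnion_ball_le {μ : Measure X} {c : ℝ≥0∞} (hdbl : IsDoubling μ c)
    (hpos : ∀ (x : X) (r : ℝ), 0 < r → 0 < μ (ball x r))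
    (hfin : ∀ (x : X) (r : ℝ), μ (ball x r) ≠ ∞) {R : ℝ} {T : Set (X × ℝ)} {t : ℝ≥0∞}
    {G : X → ℝ≥0∞} (hT : ∀ b ∈ T, (0 < b.2 ∧ b.2 ≤ R) ∧
      t * μ (ball b.1 b.2) ≤ ∫⁻ z in ball b.1 b.2, G z ∂μ) :
    t * μ (⋃ b ∈ T, ball b.1 b.2) ≤ c ^ 3 * ∫⁻ z, G z ∂μ := by
  rcases isEmpty_or_nonempty X with hX | hX
  · rw [Set.eq_empty_of_isEmpty (⋃ b ∈ T, ball b.1 b.2)]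
    simp
  have := sigmaFinite_of_measure_ball_ne_top hfin
  obtain ⟨u, huT, hdisj, hcov⟩ := Vitali.exists_disjoint_subfamily_covering_enlargement_closedBall
    T (fun b => b.1) (fun b => b.2) R (fun b hb => (hT b hb).1.2) 5 (by norm_num)
  have hdisj' : u.PairwiseDisjoint fun b => ball b.1 b.2 :=
    hdisj.mono fun b => ball_subset_closedBall
  have hu : u.Countable := by
    have h := Measure.countable_meas_pos_of_disjoint_iUnion (μ := μ)
      (As := fun b : u => ball b.1.1 b.1.2) (fun b => isOpen_ball.measurableSet)
      (fun a b hab => hdisj' a.2 b.2 (fun h => hab (Subtype.ext h)))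
    have h' : {b : u | 0 < μ (ball b.1.1 b.1.2)} = Set.univ :=
      Set.eq_univ_of_forall fun b => hpos _ _ (hT b.1 (huT b.2)).1.1
    rw [h'] at h
    exact Set.countable_coe_iff.1 (Set.countable_univ_iff.1 h)
  have hsub : (⋃ b ∈ T, ball b.1 b.2) ⊆ ⋃ b ∈ u, ball b.1 (2 ^ 3 * b.2) := by
    refine iUnion₂_subset fun b hb => ?_
    obtain ⟨a, ha, hab⟩ := hcov b hb
    refine (ball_subset_closedBall.trans hab).trans (subset_biUnion_of_mem (u := fun b : X × ℝ =>
      ball b.1 (2 ^ 3 * b.2)) ha |>.trans' ?_)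
    exact closedBall_subset_ball (by nlinarith [(hT a (huT ha)).1.1])
  calc t * μ (⋃ b ∈ T, ball b.1 b.2)
      ≤ t * ∑' b : u, μ (ball b.1.1 (2 ^ 3 * b.1.2)) := by
        gcongr
        exact (measure_mono hsub).trans (measure_biUnion_le μ hu _)
    _ = ∑' b : u, t * μ (ball b.1.1 (2 ^ 3 * b.1.2)) := ENNReal.tsum_mul_left.symm
    _ ≤ ∑' b : u, c ^ 3 * ∫⁻ z in ball b.1.1 b.1.2, G z ∂μ := by
        refine ENNReal.tsum_le_tsum fun b => ?_
        have hb := hT b.1 (huT b.2)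
        calc t * μ (ball b.1.1 (2 ^ 3 * b.1.2))
            ≤ t * (c ^ 3 * μ (ball b.1.1 b.1.2)) := by
              gcongr
              exact hdbl.measure_ball_pow_mul_le 3 _ hb.1.1
          _ = c ^ 3 * (t * μ (ball b.1.1 b.1.2)) := by ring
          _ ≤ _ := by gcongr; exact hb.2
    _ = c ^ 3 * ∑' b : u, ∫⁻ z in ball b.1.1 b.1.2, G z ∂μ := ENNReal.tsum_mul_left
    _ = c ^ 3 * ∫⁻ z in ⋃ b ∈ u, ball b.1 b.2, G z ∂μ := by
        rw [lintegral_biUnion hu (fun b _ => isOpen_ball.measurableSet) hdisj']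
    _ ≤ c ^ 3 * ∫⁻ z, G z ∂μ := by
        gcongr
        exact Measure.restrict_le_self

/-- The weak type inequality for the maximal function, localised to `{t < F}`. -/
lemma mul_measure_lt_maxFn_le {μ : Measure X} {c : ℝ≥0∞} (hdbl : IsDoubling μ c)
    (hpos : ∀ (x : X) (r : ℝ), 0 < r → 0 < μ (ball x r))
    (hfin : ∀ (x : X) (r : ℝ), μ (ball x r) ≠ ∞) (R : ℝ) {F : X → ℝ≥0∞} (hF : Measurable F)
    {t : ℝ≥0∞} (ht : t ≠ ∞) :
    t * μ {y | 2 * t < maxFn μ R F y} ≤ c ^ 3 * ∫⁻ z, {z | t < F z}.indicator F z ∂μ := by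
  rw [setOf_lt_maxFn]
  refine mul_measure_biUnion_ball_le hdbl hpos hfin (R := R) fun b hb => ⟨hb.1, ?_⟩
  have h1 : 2 * t * μ (ball b.1 b.2) ≤ ∫⁻ z in ball b.1 b.2, F z ∂μ :=
    (ENNReal.le_div_iff_mul_le (Or.inl (hpos _ _ hb.1.1).ne') (Or.inl (hfin _ _))).1 hb.2.le
  have hm : MeasurableSet {z | t < F z} := measurableSet_lt measurable_const hF
  have h2 : ∫⁻ z in ball b.1 b.2, F z ∂μ ≤
      ∫⁻ z in ball b.1 b.2, {z | t < F z}.indicator F z ∂μ + t * μ (ball b.1 b.2) := by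
    rw [← setLIntegral_const, ← lintegral_add_left (hF.indicator hm)]
    refine lintegral_mono fun z => ?_
    by_cases h : t < F z
    · simp [h]
    · simpa [h] using not_lt.1 h
  have h3 : t * μ (ball b.1 b.2) + t * μ (ball b.1 b.2) ≤
      ∫⁻ z in ball b.1 b.2, {z | t < F z}.indicator F z ∂μ + t * μ (ball b.1 b.2) := by
    rw [← two_mul, ← mul_assoc]
    exact h1.trans h2
  exact (ENNReal.add_le_add_iff_right (ENNReal.mul_ne_top ht (hfin _ _))).1 h3

/-- The maximal function is bounded on `L^p` for `1 < p`, uniformly in the bound on the radii. -/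
lemma exists_lintegral_maxFn_rpow_le {μ : Measure X} {c : ℝ≥0∞} (hc : c ≠ ∞)
    (hdbl : IsDoubling μ c) (hpos : ∀ (x : X) (r : ℝ), 0 < r → 0 < μ (ball x r))
    (hfin : ∀ (x : X) (r : ℝ), μ (ball x r) ≠ ∞) {p : ℝ} (hp : 1 < p) :
    ∃ C : ℝ≥0∞, C ≠ ∞ ∧ ∀ (R : ℝ) (F : X → ℝ≥0∞), Measurable F →
      ∫⁻ y, maxFn μ R F y ^ p ∂μ ≤ C * ∫⁻ y, F y ^ p ∂μ := by
  classical
  have hp1 : 0 < p - 1 := by linarith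
  have hz : ∀ j : ℤ, (2 : ℝ≥0∞) ^ j ≠ 0 ∧ (2 : ℝ≥0∞) ^ j ≠ ∞ := fun j =>
    ⟨(ENNReal.zpow_pos (by norm_num) (by norm_num) j).ne',
      (ENNReal.zpow_lt_top (by norm_num) (by norm_num) j).ne⟩
  refine ⟨2 ^ p * (2 ^ p * (c ^ 3 * dyadicConst (p - 1))), ?_, fun R F hF => ?_⟩
  · have := dyadicConst_ne_top hp1
    have h2 : (2 : ℝ≥0∞) ^ p ≠ ∞ := ENNReal.rpow_ne_top_of_nonneg (by linarith) (by norm_num)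
    finiteness
  have hM : ∀ j : ℤ, MeasurableSet {y | (2 : ℝ≥0∞) ^ j < maxFn μ R F y} := fun j =>
    measurableSet_lt measurable_const (measurable_maxFn μ R F)
  have hFm : ∀ j : ℤ, MeasurableSet {y | (2 : ℝ≥0∞) ^ j < F y} := fun j =>
    measurableSet_lt measurable_const hF
  have hind : ∀ (j : ℤ) (s : ℝ) (G : X → ℝ≥0∞) (y : X),
      (if (2 : ℝ≥0∞) ^ j < G y then ((2 : ℝ≥0∞) ^ j) ^ s else 0) =
        {y | (2 : ℝ≥0∞) ^ j < G y}.indicator (fun _ => ((2 : ℝ≥0∞) ^ j) ^ s) y := by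
    intro j s G y
    simp [Set.indicator_apply]
  have hlevel : ∀ j : ℤ, ((2 : ℝ≥0∞) ^ (j + 1)) ^ p * μ {y | (2 : ℝ≥0∞) ^ (j + 1) < maxFn μ R F y}
      ≤ 2 ^ p * (c ^ 3 * ∫⁻ y, F y * (if (2 : ℝ≥0∞) ^ j < F y then
        ((2 : ℝ≥0∞) ^ j) ^ (p - 1) else 0) ∂μ) := by
    intro j
    have e1 : (2 : ℝ≥0∞) ^ (j + 1) = 2 * 2 ^ j := by
      rw [ENNReal.zpow_add (by norm_num) (by norm_num), zpow_one, mul_comm]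
    have e2 : ((2 : ℝ≥0∞) ^ j) ^ p = ((2 : ℝ≥0∞) ^ j) ^ (p - 1) * 2 ^ j := by
      conv_lhs => rw [show p = (p - 1) + 1 by ring]
      rw [ENNReal.rpow_add _ _ (hz j).1 (hz j).2, ENNReal.rpow_one]
    have e3 : ∫⁻ y, F y * (if (2 : ℝ≥0∞) ^ j < F y then ((2 : ℝ≥0∞) ^ j) ^ (p - 1) else 0) ∂μ =
        ((2 : ℝ≥0∞) ^ j) ^ (p - 1) * ∫⁻ y, {y | (2 : ℝ≥0∞) ^ j < F y}.indicator F y ∂μ := by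
      rw [← lintegral_const_mul _ (hF.indicator (hFm j))]
      refine lintegral_congr fun y => ?_
      by_cases h : (2 : ℝ≥0∞) ^ j < F y
      · simp [h, mul_comm]
      · simp [h]
    rw [e3, e1, ENNReal.mul_rpow_of_nonneg _ _ (by linarith), e2]
    calc 2 ^ p * (((2 : ℝ≥0∞) ^ j) ^ (p - 1) * 2 ^ j) * μ {y | 2 * (2 : ℝ≥0∞) ^ j < maxFn μ R F y}
        = 2 ^ p * ((2 : ℝ≥0∞) ^ j) ^ (p - 1) *
            (2 ^ j * μ {y | 2 * (2 : ℝ≥0∞) ^ j < maxFn μ R F y}) := by ring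
      _ ≤ 2 ^ p * ((2 : ℝ≥0∞) ^ j) ^ (p - 1) *
            (c ^ 3 * ∫⁻ y, {y | (2 : ℝ≥0∞) ^ j < F y}.indicator F y ∂μ) := by
          exact mul_le_mul_right (mul_measure_lt_maxFn_le hdbl hpos hfin R hF (hz j).2) _
      _ = _ := by ring
  calc ∫⁻ y, maxFn μ R F y ^ p ∂μ
      ≤ ∫⁻ y, 2 ^ p * ∑' j : ℤ, (if (2 : ℝ≥0∞) ^ j < maxFn μ R F y then
          ((2 : ℝ≥0∞) ^ j) ^ p else 0) ∂μ :=
        lintegral_mono fun y => rpow_le_tsum_zpow_rpow_lt (by linarith) _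
    _ = 2 ^ p * ∑' j : ℤ, ((2 : ℝ≥0∞) ^ j) ^ p * μ {y | (2 : ℝ≥0∞) ^ j < maxFn μ R F y} := by
        simp_rw [hind]
        rw [lintegral_const_mul _ (Measurable.tsum fun j =>
            measurable_const.indicator (hM j)),
          lintegral_tsum fun j => (measurable_const.indicator (hM j)).aemeasurable]
        simp_rw [lintegral_indicator_const (hM _)]
    _ = 2 ^ p * ∑' j : ℤ, ((2 : ℝ≥0∞) ^ (j + 1)) ^ p *
          μ {y | (2 : ℝ≥0∞) ^ (j + 1) < maxFn μ R F y} := by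
        congr 1
        exact ((Equiv.addRight (1 : ℤ)).tsum_eq (fun j : ℤ => ((2 : ℝ≥0∞) ^ j) ^ p *
          μ {y | (2 : ℝ≥0∞) ^ j < maxFn μ R F y})).symm
    _ ≤ 2 ^ p * ∑' j : ℤ, 2 ^ p * (c ^ 3 * ∫⁻ y, F y * (if (2 : ℝ≥0∞) ^ j < F y then
        ((2 : ℝ≥0∞) ^ j) ^ (p - 1) else 0) ∂μ) := by
        exact mul_le_mul_right (ENNReal.tsum_le_tsum hlevel) _
    _ = 2 ^ p * (2 ^ p * (c ^ 3 * ∫⁻ y, F y * ∑' j : ℤ, (if (2 : ℝ≥0∞) ^ j < F y then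
        ((2 : ℝ≥0∞) ^ j) ^ (p - 1) else 0) ∂μ)) := by
        rw [ENNReal.tsum_mul_left, ENNReal.tsum_mul_left]
        simp_rw [hind, ← ENNReal.tsum_mul_left (a := F _)]
        rw [lintegral_tsum (f := fun (j : ℤ) y => F y * {y | (2 : ℝ≥0∞) ^ j < F y}.indicator
          (fun _ => ((2 : ℝ≥0∞) ^ j) ^ (p - 1)) y)
          fun j => (hF.mul (measurable_const.indicator (hFm j))).aemeasurable]
    _ ≤ 2 ^ p * (2 ^ p * (c ^ 3 * ∫⁻ y, dyadicConst (p - 1) * F y ^ p ∂μ)) := by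
        refine mul_le_mul_right (mul_le_mul_right (mul_le_mul_right
          (lintegral_mono fun y => ?_) _) _) _
        refine (mul_le_mul_right (tsum_zpow_rpow_lt_le hp1 _) _).trans (le_of_eq ?_)
        rw [mul_left_comm]
        congr 1
        conv_rhs => rw [show p = 1 + (p - 1) by ring]
        rw [ENNReal.rpow_add_of_nonneg _ _ zero_le_one hp1.le, ENNReal.rpow_one]
    _ = _ := by
        rw [lintegral_const_mul _ (hF.pow_const p)]
        ring

lemma ballAvg_mono {μ : Measure X} {F G : X → ℝ≥0∞} (h : ∀ x, F x ≤ G x) (x : X) (ρ : ℝ) :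
    ballAvg μ F x ρ ≤ ballAvg μ G x ρ :=
  ENNReal.div_le_div_right (lintegral_mono h) _

lemma ballAvg_le_rpow {μ : Measure X} {f : X → ℝ≥0∞} (hf : Measurable f) {p : ℝ} (hp : 1 < p)
    {x : X} {ρ : ℝ} (h0 : μ (ball x ρ) ≠ 0) (h1 : μ (ball x ρ) ≠ ∞) :
    ballAvg μ f x ρ ≤ ((∫⁻ y, f y ^ p ∂μ) / μ (ball x ρ)) ^ (1 / p) := by
  have hpq := Real.HolderConjugate.conjExponent hp
  have hp0 : 0 < p := by linarith
  set q := p.conjExponent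
  have h := ENNReal.lintegral_mul_le_Lp_mul_Lq (μ.restrict (ball x ρ)) hpq hf.aemeasurable
    (aemeasurable_const (b := (1 : ℝ≥0∞)))
  simp only [Pi.mul_apply, mul_one, ENNReal.one_rpow, lintegral_const, one_mul,
    Measure.restrict_apply_univ] at h
  have hq : 1 / q = 1 - 1 / p := by
    have := hpq.inv_add_inv_eq_one
    simp only [one_div]
    linarith
  rw [ballAvg, ENNReal.div_le_iff h0 h1]
  refine h.trans ?_
  rw [ENNReal.div_rpow_of_nonneg _ _ (by positivity), hq, ENNReal.rpow_sub _ _ h0 h1,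
    ENNReal.rpow_one]
  calc (∫⁻ y in ball x ρ, f y ^ p ∂μ) ^ (1 / p) * (μ (ball x ρ) / μ (ball x ρ) ^ (1 / p))
      ≤ (∫⁻ y, f y ^ p ∂μ) ^ (1 / p) * (μ (ball x ρ) / μ (ball x ρ) ^ (1 / p)) := by
        gcongr
        exact Measure.restrict_le_self
    _ = _ := by
        simp only [div_eq_mul_inv]
        ring

lemma lintegral_annulus_riesz_le {μ : Measure X} {c : ℝ≥0∞} (hc : c ≠ ∞) (hc0 : c ≠ 0)
    (hdbl : IsDoubling μ c) {β : ℝ} (hβ : 0 < β) {f : X → ℝ≥0∞} (x : X) {ρ : ℝ} (hρ : 0 < ρ) :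
    ∫⁻ y in {y | ρ ≤ dist x y ∧ dist x y < 2 * ρ},
        f y * (ENNReal.ofReal (dist x y ^ β) / μ (ball x (dist x y))) ∂μ ≤
      c * ENNReal.ofReal ((2 * ρ) ^ β) * ballAvg μ f x (2 * ρ) := by
  have hm : MeasurableSet {y | ρ ≤ dist x y ∧ dist x y < 2 * ρ} :=
    (measurableSet_le (f := fun _ => ρ) (g := dist x) measurable_const
      (Continuous.dist continuous_const continuous_id).measurable).inter
      (measurableSet_lt (f := dist x) (g := fun _ => 2 * ρ)
        (Continuous.dist continuous_const continuous_id).measurable measurable_const)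
  have hK : c * ENNReal.ofReal ((2 * ρ) ^ β) / μ (ball x (2 * ρ)) =
      ENNReal.ofReal ((2 * ρ) ^ β) * (c⁻¹ * μ (ball x (2 * ρ)))⁻¹ := by
    rw [ENNReal.mul_inv (Or.inl (ENNReal.inv_ne_zero.2 hc)) (Or.inl (ENNReal.inv_ne_top.2 hc0)),
      inv_inv, div_eq_mul_inv]
    ring
  calc ∫⁻ y in {y | ρ ≤ dist x y ∧ dist x y < 2 * ρ},
        f y * (ENNReal.ofReal (dist x y ^ β) / μ (ball x (dist x y))) ∂μ
      ≤ ∫⁻ y in {y | ρ ≤ dist x y ∧ dist x y < 2 * ρ},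
        (c * ENNReal.ofReal ((2 * ρ) ^ β) / μ (ball x (2 * ρ))) * f y ∂μ := by
        refine setLIntegral_mono' hm fun y hy => ?_
        rw [mul_comm]
        refine mul_le_mul_left ?_ _
        rw [hK, div_eq_mul_inv]
        refine mul_le_mul' (ENNReal.ofReal_le_ofReal ?_) (ENNReal.inv_le_inv.2 ?_)
        · exact Real.rpow_le_rpow dist_nonneg hy.2.le hβ.le
        · rw [ENNReal.inv_mul_le_iff hc0 hc]
          exact (hdbl x ρ hρ).trans (mul_le_mul_right (measure_mono (ball_subset_ball hy.1)) _)
    _ ≤ ∫⁻ y in ball x (2 * ρ),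
        (c * ENNReal.ofReal ((2 * ρ) ^ β) / μ (ball x (2 * ρ))) * f y ∂μ := by
        refine lintegral_mono_set fun y hy => ?_
        rw [mem_ball']
        exact hy.2
    _ ≤ _ := by
        rcases eq_or_ne (μ (ball x (2 * ρ))) 0 with h0 | h0
        · rw [setLIntegral_measure_zero _ _ h0]
          exact zero_le
        rw [lintegral_const_mul' _ _ (ENNReal.div_ne_top (by finiteness) h0), ballAvg,
          div_eq_mul_inv, div_eq_mul_inv]
        exact le_of_eq (by ring)

/-- The Riesz potential of `f` at points of a ball `B(x₀, r)` is controlled by a sum of averages,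
over balls of radius at most `2 * r`, of `f` plus a multiple of the indicator of `B(x₀, 4 * r)`. -/
lemma exists_rieszPot_le {μ : Measure X} [Nontrivial X] {c cσ : ℝ≥0∞} (hc : c ≠ ∞) (hc0 : c ≠ 0)
    (hdbl : IsDoubling μ c) (hpos : ∀ (x : X) (r : ℝ), 0 < r → 0 < μ (ball x r))
    (hfin : ∀ (x : X) (r : ℝ), μ (ball x r) ≠ ∞) {p β σ : ℝ} (hp : 1 < p) (hβ : 0 < β)
    (hσ : β * p < σ) (hcσ : cσ ≠ ∞) (hqrd : IsQRD μ σ cσ) :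
    ∃ C : ℝ≥0∞, C ≠ ∞ ∧ ∀ (f : X → ℝ≥0∞), Measurable f → ∀ (x x₀ : X) (r : ℝ), 0 < r →
      dist x x₀ ≤ r →
      rieszPot μ (μ.withDensity f) β x ≤ C * (ENNReal.ofReal (r ^ β) *
        ∑' n : ℕ, ((2 : ℝ≥0∞) ^ (-(β / 2))) ^ n * ((2 : ℝ≥0∞) ^ (-(β / 2))) ^ n *
          ballAvg μ (fun y => f y + (ball x₀ (4 * r)).indicator
            (fun _ => ((∫⁻ y, f y ^ p ∂μ) / μ (ball x₀ r)) ^ (1 / p)) y) x (2 * (r / 2 ^ n))) := by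
  have hp0 : 0 < p := by linarith
  set t : ℝ≥0∞ := (2 : ℝ≥0∞) ^ (-(β / 2)) with ht
  set θ : ℝ≥0∞ := (2 : ℝ≥0∞) ^ (-(σ / p - β)) with hθ
  have hθ1 : θ < 1 := two_rpow_neg_lt_one (by rw [sub_pos, lt_div_iff₀ hp0]; exact hσ)
  refine ⟨c * 2 ^ β + c * 2 ^ β * cσ ^ (1 / p) * (1 - θ)⁻¹, ?_, fun f hf x x₀ r hr hx => ?_⟩
  · have h1 : (2 : ℝ≥0∞) ^ β ≠ ∞ := ENNReal.rpow_ne_top_of_nonneg hβ.le (by norm_num)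
    have h2 : cσ ^ (1 / p) ≠ ∞ := ENNReal.rpow_ne_top_of_nonneg (by positivity) hcσ
    have h3 : (1 - θ)⁻¹ ≠ ∞ := ENNReal.inv_ne_top.2 (tsub_pos_of_lt hθ1).ne'
    finiteness
  set I := ∫⁻ y, f y ^ p ∂μ with hI
  set κ := (I / μ (ball x₀ r)) ^ (1 / p) with hκ
  set F : X → ℝ≥0∞ := fun y => f y + (ball x₀ (4 * r)).indicator (fun _ => κ) y with hF
  set k : X → ℝ≥0∞ := fun y =>
    f y * (ENNReal.ofReal (dist x y ^ β) / μ (ball x (dist x y))) with hk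
  set A : ℝ → Set X := fun ρ => {y | ρ ≤ dist x y ∧ dist x y < 2 * ρ} with hA
  set S := ∑' n : ℕ, t ^ n * t ^ n * ballAvg μ F x (2 * (r / 2 ^ n)) with hS
  have two_ofReal : ∀ e : ℝ, ENNReal.ofReal ((2 : ℝ) ^ e) = (2 : ℝ≥0∞) ^ e := by
    intro e
    rw [← ENNReal.ofReal_rpow_of_pos two_pos]; simp
  have hstep : rieszPot μ (μ.withDensity f) β x ≤
      ∑' n : ℕ, ∫⁻ y in A (r / 2 ^ n), k y ∂μ + ∑' j : ℕ, ∫⁻ y in A (2 ^ j * (2 * r)), k y ∂μ := by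
    have hcov : ({x}ᶜ : Set X) ⊆ (⋃ n : ℕ, A (r / 2 ^ n)) ∪ ⋃ j : ℕ, A (2 ^ j * (2 * r)) := by
      intro y hy
      have hd : 0 < dist x y := dist_pos.2 (Ne.symm hy)
      obtain ⟨m, hm1, hm2⟩ := exists_mem_Ico_zpow (show 0 < dist x y / (2 * r) by positivity)
        (one_lt_two (α := ℝ))
      rw [le_div_iff₀ (by positivity)] at hm1
      rw [div_lt_iff₀ (by positivity)] at hm2
      rcases le_or_gt 0 m with hm | hm
      · obtain ⟨j, rfl⟩ := Int.eq_ofNat_of_zero_le hm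
        refine Or.inr (mem_iUnion.2 ⟨j, ?_, ?_⟩)
        · exact_mod_cast hm1
        · rw [zpow_add₀ (by norm_num), zpow_one, zpow_natCast] at hm2
          linarith
      · obtain ⟨n, hn⟩ := Int.eq_ofNat_of_zero_le (show 0 ≤ -m - 1 by omega)
        refine Or.inl (mem_iUnion.2 ⟨n, ?_, ?_⟩)
        · have : m = -(n : ℤ) - 1 := by omega
          rw [this, zpow_sub₀ (by norm_num), zpow_neg, zpow_natCast, zpow_one] at hm1
          calc r / 2 ^ n = (2 ^ n)⁻¹ / 2 * (2 * r) := by field_simp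
            _ ≤ _ := hm1
        · have : m + 1 = -(n : ℤ) := by omega
          rw [this, zpow_neg, zpow_natCast] at hm2
          calc dist x y < (2 ^ n)⁻¹ * (2 * r) := hm2
            _ = 2 * (r / 2 ^ n) := by field_simp
    calc rieszPot μ (μ.withDensity f) β x ≤ ∫⁻ y in {x}ᶜ, k y ∂μ := by
          rw [rieszPot, restrict_withDensity (measurableSet_singleton x).compl]
          exact lintegral_withDensity_le_lintegral_mul _ hf _
      _ ≤ ∫⁻ y in (⋃ n : ℕ, A (r / 2 ^ n)) ∪ ⋃ j : ℕ, A (2 ^ j * (2 * r)), k y ∂μ :=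
          lintegral_mono_set hcov
      _ ≤ _ := (lintegral_union_le _ _ _).trans
          (add_le_add (lintegral_iUnion_le _ _) (lintegral_iUnion_le _ _))
  have hnear : ∑' n : ℕ, ∫⁻ y in A (r / 2 ^ n), k y ∂μ ≤
      c * 2 ^ β * (ENNReal.ofReal (r ^ β) * S) := by
    rw [hS, ← ENNReal.tsum_mul_left, ← ENNReal.tsum_mul_left]
    refine ENNReal.tsum_le_tsum fun n => ?_
    refine (lintegral_annulus_riesz_le hc hc0 hdbl hβ x (ρ := r / 2 ^ n) (by positivity)).trans ?_
    have e : ENNReal.ofReal ((2 * (r / 2 ^ n)) ^ β) =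
        2 ^ β * ENNReal.ofReal (r ^ β) * (t ^ n * t ^ n) := by
      have e1 : t ^ n * t ^ n = (2 : ℝ≥0∞) ^ (-(β * n)) := by
        rw [ht, ← ENNReal.rpow_natCast, ← ENNReal.rpow_mul,
          ← ENNReal.rpow_add _ _ (by norm_num) (by norm_num)]
        congr 1; ring
      rw [e1, ← two_ofReal, ← two_ofReal, ← ENNReal.ofReal_mul (by positivity),
        ← ENNReal.ofReal_mul (by positivity)]
      congr 1
      rw [Real.mul_rpow (by norm_num) (by positivity), Real.div_rpow hr.le (by positivity),
        ← Real.rpow_natCast, ← Real.rpow_mul (by norm_num), Real.rpow_neg (by norm_num),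
        mul_comm (n : ℝ) β]
      ring
    rw [e]
    calc c * (2 ^ β * ENNReal.ofReal (r ^ β) * (t ^ n * t ^ n)) * ballAvg μ f x (2 * (r / 2 ^ n))
        ≤ c * (2 ^ β * ENNReal.ofReal (r ^ β) * (t ^ n * t ^ n)) *
            ballAvg μ F x (2 * (r / 2 ^ n)) :=
          mul_le_mul_right (ballAvg_mono (fun y => le_self_add) _ _) _
      _ = _ := by ring
  have hball : ball x₀ r ⊆ ball x (2 * r) := by
    refine ball_subset_ball' ?_
    rw [dist_comm]; linarith
  have hκS : κ ≤ S := by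
    have hb : μ (ball x (2 * r)) ≠ 0 := (hpos _ _ (by positivity)).ne'
    have h1 : κ ≤ ballAvg μ F x (2 * r) := by
      rw [ballAvg, ENNReal.le_div_iff_mul_le (Or.inl hb) (Or.inl (hfin _ _)), ← setLIntegral_const]
      refine setLIntegral_mono' measurableSet_ball fun y hy => ?_
      have : y ∈ ball x₀ (4 * r) := by
        rw [mem_ball] at hy ⊢
        linarith [dist_triangle y x x₀]
      simp [hF, this]
    calc κ ≤ ballAvg μ F x (2 * r) := h1
      _ = t ^ 0 * t ^ 0 * ballAvg μ F x (2 * (r / 2 ^ 0)) := by simp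
      _ ≤ S := ENNReal.le_tsum (f := fun n : ℕ => t ^ n * t ^ n * ballAvg μ F x (2 * (r / 2 ^ n))) 0
  have hfar : ∑' j : ℕ, ∫⁻ y in A (2 ^ j * (2 * r)), k y ∂μ ≤
      c * 2 ^ β * cσ ^ (1 / p) * (1 - θ)⁻¹ * (ENNReal.ofReal (r ^ β) * κ) := by
    have hterm : ∀ j : ℕ, ∫⁻ y in A (2 ^ j * (2 * r)), k y ∂μ ≤
        c * 2 ^ β * cσ ^ (1 / p) * (ENNReal.ofReal (r ^ β) * κ) * θ ^ j := by
      intro j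
      rcases (A (2 ^ j * (2 * r))).eq_empty_or_nonempty with h | ⟨y, hy⟩
      · rw [h]; simp
      set ρ : ℝ := 2 ^ j * (2 * r) with hρ
      have hρ0 : 0 < ρ := by positivity
      have h2j : (1 : ℝ) ≤ 2 ^ j := one_le_pow₀ one_le_two
      have hq := hqrd x (2 * r) (2 * ρ) (by positivity) (by rw [hρ]; nlinarith) (by
        rw [ENNReal.ofReal_mul (by norm_num)]
        refine mul_le_mul' (by simp) ?_
        calc ENNReal.ofReal ρ ≤ ENNReal.ofReal (dist x y) := ENNReal.ofReal_le_ofReal hy.1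
          _ = edist x y := (edist_dist x y).symm
          _ ≤ _ := Metric.edist_le_ediam_of_mem (mem_univ x) (mem_univ y))
      have hb0 : μ (ball x (2 * ρ)) ≠ 0 := (hpos _ _ (by positivity)).ne'
      refine (lintegral_annulus_riesz_le hc hc0 hdbl hβ x hρ0).trans ?_
      have hratio : (2 * r) / (2 * ρ) = (2 ^ (j + 1))⁻¹ := by
        rw [hρ]; field_simp; ring
      have hx0 : μ (ball x₀ r) ≤ cσ * ENNReal.ofReal (((2 ^ (j + 1))⁻¹ : ℝ) ^ σ) *
          μ (ball x (2 * ρ)) := by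
        rw [← hratio]; exact (measure_mono hball).trans hq
      have havg : ballAvg μ f x (2 * ρ) ≤
          cσ ^ (1 / p) * (2 : ℝ≥0∞) ^ (-((j + 1) * (σ / p))) * κ := by
        refine (ballAvg_le_rpow hf hp hb0 (hfin _ _)).trans ?_
        have e : (2 : ℝ≥0∞) ^ (-((j + 1) * (σ / p))) =
            (ENNReal.ofReal (((2 ^ (j + 1))⁻¹ : ℝ) ^ σ)) ^ (1 / p) := by
          rw [← Real.rpow_natCast, ← Real.rpow_neg (by norm_num), ← Real.rpow_mul (by norm_num),
            two_ofReal, ← ENNReal.rpow_mul]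
          congr 1
          push_cast
          field_simp
        rw [e, hκ, ← ENNReal.mul_rpow_of_nonneg _ _ (by positivity),
          ← ENNReal.mul_rpow_of_nonneg _ _ (by positivity)]
        refine ENNReal.rpow_le_rpow ?_ (by positivity)
        have hx00 : μ (ball x₀ r) ≠ 0 := (hpos _ _ hr).ne'
        rw [ENNReal.div_le_iff hb0 (hfin _ _)]
        calc I = I / μ (ball x₀ r) * μ (ball x₀ r) :=
              (ENNReal.div_mul_cancel hx00 (hfin _ _)).symm
          _ ≤ I / μ (ball x₀ r) * (cσ * ENNReal.ofReal (((2 ^ (j + 1))⁻¹ : ℝ) ^ σ) *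
                μ (ball x (2 * ρ))) := by gcongr
          _ = _ := by ring
      have eρ : ENNReal.ofReal ((2 * ρ) ^ β) =
          2 ^ β * ENNReal.ofReal (r ^ β) * (2 : ℝ≥0∞) ^ ((j + 1) * β) := by
        rw [← two_ofReal, ← two_ofReal, ← ENNReal.ofReal_mul (by positivity),
          ← ENNReal.ofReal_mul (by positivity)]
        congr 1
        have : 2 * ρ = 2 * r * 2 ^ ((j : ℝ) + 1) := by
          rw [hρ, Real.rpow_add_one (by norm_num), Real.rpow_natCast]; ring
        rw [this, Real.mul_rpow (by positivity) (by positivity),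
          Real.mul_rpow (by positivity) (by positivity), ← Real.rpow_mul (by norm_num)]
      have eθ : (2 : ℝ≥0∞) ^ ((j + 1) * β) * (2 : ℝ≥0∞) ^ (-((j + 1) * (σ / p))) ≤ θ ^ j := by
        rw [← ENNReal.rpow_add _ _ (by norm_num) (by norm_num)]
        have : (j + 1) * β + -((j + 1) * (σ / p)) = -(σ / p - β) * ((j + 1 : ℕ) : ℝ) := by
          push_cast; ring
        rw [this, ENNReal.rpow_mul, ENNReal.rpow_natCast]
        exact pow_le_pow_right_of_le_one' hθ1.le (Nat.le_succ j)
      calc c * ENNReal.ofReal ((2 * ρ) ^ β) * ballAvg μ f x (2 * ρ)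
          ≤ c * (2 ^ β * ENNReal.ofReal (r ^ β) * (2 : ℝ≥0∞) ^ ((j + 1) * β)) *
            (cσ ^ (1 / p) * (2 : ℝ≥0∞) ^ (-((j + 1) * (σ / p))) * κ) := by
            rw [eρ]; gcongr
        _ = c * 2 ^ β * cσ ^ (1 / p) * (ENNReal.ofReal (r ^ β) * κ) *
            ((2 : ℝ≥0∞) ^ ((j + 1) * β) * (2 : ℝ≥0∞) ^ (-((j + 1) * (σ / p)))) := by ring
        _ ≤ _ := by gcongr
    refine (ENNReal.tsum_le_tsum hterm).trans (le_of_eq ?_)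
    rw [ENNReal.tsum_mul_left, ENNReal.tsum_geometric]
    ring
  calc rieszPot μ (μ.withDensity f) β x
      ≤ c * 2 ^ β * (ENNReal.ofReal (r ^ β) * S) +
        c * 2 ^ β * cσ ^ (1 / p) * (1 - θ)⁻¹ * (ENNReal.ofReal (r ^ β) * S) := by
        refine hstep.trans (add_le_add hnear (hfar.trans ?_))
        gcongr
    _ = _ := by ring

/-! ### Record indices of a sequence -/

/-- The index `n` is a record of the weighted sequence `t ^ m * a m`. -/
def IsRecord (t : ℝ≥0∞) (a : ℕ → ℝ≥0∞) (n : ℕ) : Prop :=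
  ∀ m ≤ n, t ^ m * a m ≤ t ^ n * a n

open Classical in
/-- The sum `∑ t ^ (2 * n) * a n` is controlled by its restriction to the record indices. -/
lemma tsum_le_tsum_isRecord (t : ℝ≥0∞) (a : ℕ → ℝ≥0∞) :
    ∑' n, t ^ n * t ^ n * a n ≤
      (1 - t)⁻¹ * ∑' n, if IsRecord t a n then t ^ n * t ^ n * a n else 0 := by
  set b : ℕ → ℝ≥0∞ := fun n => if IsRecord t a n then t ^ n * a n else 0 with hb
  have hmax : ∀ n, t ^ n * a n ≤ ∑' m, if m ≤ n then b m else 0 := by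
    intro n
    obtain ⟨m, hm, hmn⟩ := Finset.exists_max_image (Finset.range (n + 1))
      (fun m => t ^ m * a m) ⟨n, by simp⟩
    have hm' : m ≤ n := by simpa [Nat.lt_succ_iff] using hm
    have hrec : IsRecord t a m := fun l hl => hmn l (by simp; omega)
    calc t ^ n * a n ≤ t ^ m * a m := hmn n (by simp)
      _ = if m ≤ n then b m else 0 := by simp [hb, hm', hrec]
      _ ≤ _ := ENNReal.le_tsum m
  have hgeom : ∀ m : ℕ, ∑' n : ℕ, (if m ≤ n then t ^ n else 0) = t ^ m * (1 - t)⁻¹ := by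
    intro m
    have hinj : Function.Injective (fun i : ℕ => m + i) := add_right_injective m
    rw [← hinj.tsum_eq]
    · simp_rw [← ENNReal.tsum_geometric, ← ENNReal.tsum_mul_left, ← pow_add]
      simp
    · intro n hn
      have : m ≤ n := by
        by_contra h
        simp [h] at hn
      exact ⟨n - m, by simp [this]⟩
  calc ∑' n, t ^ n * t ^ n * a n ≤ ∑' n, t ^ n * ∑' m, (if m ≤ n then b m else 0) := by
        refine ENNReal.tsum_le_tsum fun n => ?_
        rw [mul_assoc]
        exact mul_le_mul_right (hmax n) _
    _ = ∑' m, ∑' n, b m * (if m ≤ n then t ^ n else 0) := by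
        simp_rw [← ENNReal.tsum_mul_left]
        rw [ENNReal.tsum_comm]
        refine tsum_congr fun m => tsum_congr fun n => ?_
        split_ifs <;> simp [mul_comm]
    _ = (1 - t)⁻¹ * ∑' n, if IsRecord t a n then t ^ n * t ^ n * a n else 0 := by
        rw [← ENNReal.tsum_mul_left]
        refine tsum_congr fun m => ?_
        rw [ENNReal.tsum_mul_left, hgeom]
        simp only [hb]
        split_ifs
        · ring
        · simp

/-- A finite sum whose terms decay geometrically going back from every nonzero term. -/
lemma sum_range_le_of_decay {t D M : ℝ≥0∞} {a : ℕ → ℝ≥0∞} (hM : ∀ n, a n ≤ M)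
    (hdecay : ∀ m n, 1 ≤ m → m ≤ n → a n ≠ 0 → a m ≤ D * t ^ (n - m) * M) (N : ℕ) :
    ∑ n ∈ Finset.range N, a n ≤ (1 + D * (1 - t)⁻¹) * M := by
  have key : ∀ N, ∑ n ∈ Finset.range N, a (n + 1) ≤ D * (1 - t)⁻¹ * M := by
    intro N
    induction N with
    | zero => simp
    | succ N ih =>
      rcases eq_or_ne (a (N + 1)) 0 with h | h
      · rw [Finset.sum_range_succ, h, add_zero]
        exact ih
      · calc ∑ n ∈ Finset.range (N + 1), a (n + 1)
            ≤ ∑ n ∈ Finset.range (N + 1), D * t ^ (N - n) * M := by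
              refine Finset.sum_le_sum fun n hn => ?_
              have hn' : n < N + 1 := Finset.mem_range.1 hn
              have := hdecay (n + 1) (N + 1) (by omega) (by omega) h
              rwa [Nat.add_sub_add_right] at this
          _ = D * (∑ n ∈ Finset.range (N + 1), t ^ n) * M := by
              rw [← Finset.sum_mul, ← Finset.mul_sum]
              congr 2
              exact Finset.sum_range_reflect (fun n => t ^ n) (N + 1)
          _ ≤ D * (1 - t)⁻¹ * M := by
              rw [← ENNReal.tsum_geometric]
              gcongr
              exact ENNReal.sum_le_tsum _
  calc ∑ n ∈ Finset.range N, a n ≤ ∑ n ∈ Finset.range (N + 1), a n :=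
        Finset.sum_le_sum_of_subset (Finset.range_mono (Nat.le_succ N))
    _ = ∑ n ∈ Finset.range N, a (n + 1) + a 0 := Finset.sum_range_succ' _ _
    _ ≤ D * (1 - t)⁻¹ * M + M := add_le_add (key N) (hM 0)
    _ = _ := by ring

/-! ### Suprema of bumps -/

/-- The supremum of `a` over the points of `S` at distance less than `s` from `x`. -/
def ballSup (S : Set X) (a : X → ℝ≥0∞) (s : ℝ) (x : X) : ℝ≥0∞ :=
  ⨆ z ∈ {z | z ∈ S ∧ dist x z < s}, a z

/-- The supremum of the bumps of height `a z` and radius `s` centered at the points `z ∈ S`. -/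
def bumpSup (S : Set X) (a : X → ℝ≥0∞) (s : ℝ) (x : X) : ℝ≥0∞ :=
  ⨆ z ∈ S, a z * ENNReal.ofReal (1 - dist x z / s)

lemma measurable_ballSup (S : Set X) (a : X → ℝ≥0∞) (s : ℝ) : Measurable (ballSup S a s) := by
  refine measurable_of_Ioi fun t => ?_
  have : ballSup S a s ⁻¹' Ioi t = ⋃ z ∈ {z | z ∈ S ∧ t < a z}, ball z s := by
    ext x
    simp only [ballSup, mem_preimage, mem_Ioi, lt_iSup_iff, mem_iUnion, mem_ball, exists_prop,
      mem_ofPred_eq]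
    tauto
  rw [this]
  exact (isOpen_biUnion fun _ _ => isOpen_ball).measurableSet

lemma ballSup_le {S : Set X} {a : X → ℝ≥0∞} {s : ℝ} {x : X} {M : ℝ≥0∞}
    (h : ∀ z ∈ S, dist x z < s → a z ≤ M) : ballSup S a s x ≤ M :=
  iSup₂_le fun z hz => h z hz.1 hz.2

lemma le_ballSup {S : Set X} {a : X → ℝ≥0∞} {s : ℝ} {x z : X} (hz : z ∈ S) (h : dist x z < s) :
    a z ≤ ballSup S a s x :=
  le_iSup₂ (f := fun z (_ : z ∈ {z | z ∈ S ∧ dist x z < s}) => a z) z ⟨hz, h⟩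

lemma le_bumpSup {S : Set X} {a : X → ℝ≥0∞} {s : ℝ} {x : X} (hx : x ∈ S) :
    a x ≤ bumpSup S a s x := by
  refine le_trans ?_ (le_iSup₂
    (f := fun z (_ : z ∈ S) => a z * ENNReal.ofReal (1 - dist x z / s)) x hx)
  simp

lemma bumpSup_le_ballSup {S : Set X} {a : X → ℝ≥0∞} {s : ℝ} (hs : 0 < s) (x : X) :
    bumpSup S a s x ≤ ballSup S a s x := by
  refine iSup₂_le fun z hz => ?_
  rcases lt_or_ge (dist x z) s with h | h
  · calc a z * ENNReal.ofReal (1 - dist x z / s) ≤ a z * ENNReal.ofReal 1 := by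
          gcongr
          have : 0 ≤ dist x z / s := by positivity
          linarith
      _ ≤ _ := by simpa using le_ballSup hz h
  · rw [ENNReal.ofReal_of_nonpos, mul_zero]
    · exact zero_le
    · rw [sub_nonpos, one_le_div hs]
      exact h

lemma bumpSup_le_add {S : Set X} {a : X → ℝ≥0∞} {s : ℝ} (hs : 0 < s) (x y : X) :
    bumpSup S a s x ≤
      bumpSup S a s y + ENNReal.ofReal (min 1 (dist x y / s)) * ballSup S a s x := by
  refine iSup₂_le fun z hz => ?_
  rcases lt_or_ge (dist x z) s with h | h
  · have h1 : 1 - dist x z / s ≤ max 0 (1 - dist y z / s) + min 1 (dist x y / s) := by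
      rcases le_total 1 (dist x y / s) with h' | h'
      · rw [min_eq_left h']
        have : 0 ≤ dist x z / s := by positivity
        linarith [le_max_left 0 (1 - dist y z / s)]
      · rw [min_eq_right h']
        have : dist y z / s ≤ dist x y / s + dist x z / s := by
          rw [← add_div]
          gcongr
          rw [dist_comm x y]
          exact dist_triangle _ _ _
        linarith [le_max_right 0 (1 - dist y z / s)]
    calc a z * ENNReal.ofReal (1 - dist x z / s)
        ≤ a z * ENNReal.ofReal (max 0 (1 - dist y z / s) + min 1 (dist x y / s)) := by gcongr
      _ ≤ a z * (ENNReal.ofReal (max 0 (1 - dist y z / s)) +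
            ENNReal.ofReal (min 1 (dist x y / s))) := by
          gcongr
          exact ENNReal.ofReal_add_le
      _ = a z * ENNReal.ofReal (1 - dist y z / s) +
            ENNReal.ofReal (min 1 (dist x y / s)) * a z := by
          rw [ENNReal.ofReal_max]
          simp
          ring
      _ ≤ _ := by
          refine add_le_add ?_ (mul_le_mul_right (le_ballSup hz h) _)
          exact le_iSup₂ (f := fun z (_ : z ∈ S) => a z * ENNReal.ofReal (1 - dist y z / s)) z hz
  · rw [ENNReal.ofReal_of_nonpos, mul_zero]
    · exact zero_le
    · rw [sub_nonpos, one_le_div hs]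
      exact h

lemma lqNorm_le_tsum {q : ℝ≥0∞} (hq : 1 ≤ q) (a : ℤ → ℝ≥0∞) : lqNorm q a ≤ ∑' k, a k := by
  rw [lqNorm]
  split_ifs with h
  · exact iSup_le fun k => ENNReal.le_tsum k
  have hq1 : 1 ≤ q.toReal := by
    rw [← ENNReal.toReal_one]
    exact ENNReal.toReal_mono h hq
  have hq0 : 0 < q.toReal := by linarith
  have hsplit : ∀ b : ℝ≥0∞, b ^ q.toReal = b * b ^ (q.toReal - 1) := by
    intro b
    conv_lhs => rw [show q.toReal = 1 + (q.toReal - 1) by ring]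
    rw [ENNReal.rpow_add_of_nonneg _ _ zero_le_one (by linarith), ENNReal.rpow_one]
  rw [one_div, ENNReal.rpow_inv_le_iff hq0, hsplit, ← ENNReal.tsum_mul_right]
  refine ENNReal.tsum_le_tsum fun k => ?_
  rw [hsplit]
  exact mul_le_mul_right (ENNReal.rpow_le_rpow (ENNReal.le_tsum k) (by linarith)) _

lemma ofReal_abs_toReal_sub_le {a b d : ℝ≥0∞} (ha : a ≠ ∞) (hb : b ≠ ∞) (hab : a ≤ b + d)
    (hba : b ≤ a + d) : ENNReal.ofReal |a.toReal - b.toReal| ≤ d := by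
  rcases eq_or_ne d ∞ with rfl | hd
  · exact le_top
  refine ENNReal.ofReal_le_of_le_toReal ?_
  have h1 := ENNReal.toReal_mono (by finiteness) hab
  have h2 := ENNReal.toReal_mono (by finiteness) hba
  rw [ENNReal.toReal_add hb hd] at h1
  rw [ENNReal.toReal_add ha hd] at h2
  rw [abs_le]
  constructor <;> linarith

lemma continuous_bumpSup {S : Set X} {a : X → ℝ≥0∞} {s : ℝ} (hs : 0 < s) {Q : ℝ≥0∞} (hQ : Q ≠ ∞)
    (ha : ∀ z ∈ S, a z ≤ Q) : Continuous (bumpSup S a s) := by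
  refine continuous_of_le_add_edist (ENNReal.ofReal (1 / s) * Q) (by finiteness) fun x y => ?_
  refine (bumpSup_le_add hs x y).trans (add_le_add_right ?_ _)
  calc ENNReal.ofReal (min 1 (dist x y / s)) * ballSup S a s x
      ≤ ENNReal.ofReal (1 / s * dist x y) * Q := by
        refine mul_le_mul' (ENNReal.ofReal_le_ofReal ?_) (ballSup_le fun z hz _ => ha z hz)
        rw [one_div_mul_eq_div]
        exact min_le_right _ _
    _ = ENNReal.ofReal (1 / s) * Q * edist x y := by
        rw [ENNReal.ofReal_mul (by positivity), edist_dist]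
        ring

lemma min_one_div_le_rpow_mul {β d s : ℝ} (hβ : 0 < β) (hs : 0 < s) {k : ℤ}
    (h1 : (2 : ℝ) ^ (-k - 1) ≤ d) (h2 : d < (2 : ℝ) ^ (-k)) :
    min 1 (d / s) ≤ d ^ β * (((2 : ℝ) ^ (k + 1)) ^ β * min 1 ((2 : ℝ) ^ (-k) / s)) := by
  have hd : 0 < d := lt_of_lt_of_le (by positivity) h1
  have h3 : 1 ≤ d ^ β * ((2 : ℝ) ^ (k + 1)) ^ β := by
    rw [← Real.mul_rpow hd.le (by positivity)]
    refine Real.one_le_rpow ?_ hβ.le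
    calc (1 : ℝ) = (2 : ℝ) ^ (-k - 1) * (2 : ℝ) ^ (k + 1) := by
          rw [← zpow_add₀ (by norm_num)]
          simp
      _ ≤ _ := by gcongr
  rw [← mul_assoc]
  calc min 1 (d / s) ≤ min 1 ((2 : ℝ) ^ (-k) / s) := by gcongr
    _ ≤ _ := le_mul_of_one_le_left (by positivity) h3

/-- Finite sums of suprema of bumps centered in `E` are admissible for the capacity of `E`. -/
lemma exists_relCap_le_lintegral_sum {μ : Measure X} {β p : ℝ} {q : ℝ≥0∞} (hp : 0 < p)
    (hβ : 0 < β) (hq : 1 ≤ q) {x₀ : X} {r : ℝ} (Λ : ℝ) {E : Set X} (hE : IsCompact E)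
    (hEr : E ⊆ closedBall x₀ r) {S : ℕ → Set X} (hS : ∀ n, S n ⊆ E) {a : ℕ → X → ℝ≥0∞} {s : ℕ → ℝ}
    (hs : ∀ n, 0 < s n) (hsr : ∀ n, s n ≤ r) {Q W : ℕ → ℝ≥0∞} (hQ : ∀ n, Q n ≠ ∞)
    (hW : ∀ n, W n ≠ ∞) (ha : ∀ n, ∀ z ∈ S n, a n z ≤ Q n)
    (h1 : ∀ x ∈ E, 1 < ∑' n, W n * bumpSup (S n) (a n) (s n) x) :
    ∃ N : ℕ, relCap μ β p q E x₀ r Λ ≤ ∫⁻ x, (∑ n ∈ Finset.range N, W n *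
      (∑' k : ℤ, ENNReal.ofReal (((2 : ℝ) ^ (k + 1)) ^ β * min 1 ((2 : ℝ) ^ (-k) / s n))) *
        ballSup (S n) (a n) (s n) x) ^ p ∂μ := by
  set U : ℕ → X → ℝ≥0∞ := fun N x =>
    ∑ n ∈ Finset.range N, W n * bumpSup (S n) (a n) (s n) x with hU
  have hbump : ∀ n x, bumpSup (S n) (a n) (s n) x ≠ ∞ := fun n x =>
    ne_top_of_le_ne_top (hQ n) ((bumpSup_le_ballSup (hs n) x).trans
      (ballSup_le fun z hz _ => ha n z hz))
  have hUtop : ∀ N x, U N x ≠ ∞ := fun N x =>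
    ENNReal.sum_ne_top.2 fun n _ => ENNReal.mul_ne_top (hW n) (hbump n x)
  have hUcont : ∀ N, Continuous (U N) := fun N =>
    continuous_finsetSum _ fun n _ => (ENNReal.continuous_const_mul (hW n)).comp
      (continuous_bumpSup (hs n) (hQ n) (ha n))
  have hUmono : Monotone U := fun M N hMN x =>
    Finset.sum_le_sum_of_subset (Finset.range_mono hMN)
  obtain ⟨N, hN⟩ : ∃ N, E ⊆ {x | 1 < U N x} := by
    refine hE.elim_directed_cover (fun N => {x | 1 < U N x})
      (fun N => isOpen_lt continuous_const (hUcont N)) (fun x hx => ?_) ?_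
    · have h := h1 x hx
      rw [ENNReal.tsum_eq_iSup_nat, lt_iSup_iff] at h
      exact mem_iUnion.2 h
    · exact directed_of_isDirected_le fun M N hMN x hx => lt_of_lt_of_le hx (hUmono hMN x)
  refine ⟨N, ?_⟩
  set w : ℤ → ℕ → ℝ≥0∞ := fun k n =>
    ENNReal.ofReal (((2 : ℝ) ^ (k + 1)) ^ β * min 1 ((2 : ℝ) ^ (-k) / s n)) with hw
  set g : ℤ → X → ℝ≥0∞ := fun k x =>
    ∑ n ∈ Finset.range N, W n * w k n * ballSup (S n) (a n) (s n) x with hg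
  have hstep : ∀ (k : ℤ) (x y : X), (2 : ℝ) ^ (-k - 1) ≤ dist x y → dist x y < (2 : ℝ) ^ (-k) →
      U N x ≤ U N y + ENNReal.ofReal (dist x y ^ β) * g k x := by
    intro k x y hk1 hk2
    simp only [hU, hg]
    rw [Finset.mul_sum, ← Finset.sum_add_distrib]
    refine Finset.sum_le_sum fun n _ => ?_
    calc W n * bumpSup (S n) (a n) (s n) x
        ≤ W n * (bumpSup (S n) (a n) (s n) y +
            ENNReal.ofReal (dist x y ^ β) * w k n * ballSup (S n) (a n) (s n) x) := by
          refine mul_le_mul_right ((bumpSup_le_add (hs n) x y).trans (add_le_add_right ?_ _)) _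
          refine mul_le_mul_left ?_ _
          rw [hw, ← ENNReal.ofReal_mul (by positivity)]
          exact ENNReal.ofReal_le_ofReal (min_one_div_le_rpow_mul hβ (hs n) hk1 hk2)
      _ = _ := by ring
  have hgrad : IsFracGrad μ β (ball x₀ (Λ * r)) (fun x => (U N x).toReal) g := by
    refine ⟨fun k => Finset.measurable_sum _ fun n _ =>
      (measurable_ballSup _ _ _).const_mul _, ∅, empty_subset _, measure_empty, ?_⟩
    intro k x _ y _ hk1 hk2
    refine ofReal_abs_toReal_sub_le (hUtop N x) (hUtop N y) ?_ ?_
    · refine (hstep k x y hk1 hk2).trans ?_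
      gcongr
      exact le_self_add
    · refine (hstep k y x (by rwa [dist_comm]) (by rwa [dist_comm])).trans ?_
      rw [dist_comm y x]
      gcongr
      exact le_add_self
  have hzero : ∀ x ∉ ball x₀ (2 * r), (U N x).toReal = 0 := by
    intro x hx
    suffices h : U N x = 0 by simp [h]
    refine Finset.sum_eq_zero fun n _ => ?_
    suffices h : bumpSup (S n) (a n) (s n) x = 0 by simp [h]
    refine nonpos_iff_eq_zero.1 ((bumpSup_le_ballSup (hs n) x).trans
      (ballSup_le fun z hz hxz => absurd ?_ hx))
    have hz' : dist z x₀ ≤ r := hEr (hS n hz)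
    rw [mem_ball]
    linarith [dist_triangle x z x₀, hsr n]
  have hadm : Continuous (fun x => (U N x).toReal) ∧ (∀ x ∈ E, 1 ≤ (U N x).toReal) ∧
      ∀ x ∉ ball x₀ (2 * r), (U N x).toReal = 0 := by
    refine ⟨ENNReal.continuousOn_toReal.comp_continuous (hUcont N) (hUtop N), fun x hx => ?_, hzero⟩
    rw [← ENNReal.toReal_one]
    exact ENNReal.toReal_mono (hUtop N x) (hN hx).le
  calc relCap μ β p q E x₀ r Λ
      ≤ htlSeminorm μ β p q (ball x₀ (Λ * r)) (fun x => (U N x).toReal) ^ p :=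
        iInf_le (fun φ : {φ : X → ℝ // Continuous φ ∧ (∀ x ∈ E, 1 ≤ φ x) ∧
          ∀ x ∉ ball x₀ (2 * r), φ x = 0} =>
            htlSeminorm μ β p q (ball x₀ (Λ * r)) φ.1 ^ p) ⟨_, hadm⟩
    _ ≤ mixedNorm μ (ball x₀ (Λ * r)) p q g ^ p :=
        ENNReal.rpow_le_rpow (iInf_le (fun g : {g : ℤ → X → ℝ≥0∞ // IsFracGrad μ β
          (ball x₀ (Λ * r)) (fun x => (U N x).toReal) g} =>
            mixedNorm μ (ball x₀ (Λ * r)) p q g.1) ⟨g, hgrad⟩) hp.le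
    _ = ∫⁻ x in ball x₀ (Λ * r), lqNorm q (fun k => g k x) ^ p ∂μ := by
        rw [mixedNorm, ← ENNReal.rpow_mul, one_div_mul_cancel hp.ne', ENNReal.rpow_one]
    _ ≤ ∫⁻ x, (∑' k, g k x) ^ p ∂μ :=
        lintegral_mono' Measure.restrict_le_self
          fun x => ENNReal.rpow_le_rpow (lqNorm_le_tsum hq _) hp.le
    _ = _ := by
        refine lintegral_congr fun x => ?_
        simp only [hg]
        rw [Summable.tsum_finsetSum fun _ _ => ENNReal.summable]
        simp_rw [ENNReal.tsum_mul_right, ENNReal.tsum_mul_left, hw]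

/-! ### Comparison of capacities -/

lemma ballAvg_le_mul_ballAvg {μ : Measure X} {c : ℝ≥0∞} (hdbl : IsDoubling μ c)
    (hpos : ∀ (x : X) (r : ℝ), 0 < r → 0 < μ (ball x r))
    (hfin : ∀ (x : X) (r : ℝ), μ (ball x r) ≠ ∞) (F : X → ℝ≥0∞) {w z : X} {ρ : ℝ} (hρ : 0 < ρ)
    (h : dist w z ≤ ρ) : ballAvg μ F w ρ ≤ c ^ 2 * ballAvg μ F z (2 * ρ) := by
  have h1 : μ (ball z (2 * ρ)) ≤ c ^ 2 * μ (ball w ρ) := by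
    refine (measure_mono (ball_subset_ball' ?_)).trans (hdbl.measure_ball_pow_mul_le 2 w hρ)
    rw [dist_comm]
    linarith
  have h2 : ∫⁻ y in ball w ρ, F y ∂μ ≤ ∫⁻ y in ball z (2 * ρ), F y ∂μ :=
    lintegral_mono_set (ball_subset_ball' (by linarith))
  rw [ballAvg, ENNReal.div_le_iff (hpos _ _ hρ).ne' (hfin _ _)]
  calc ∫⁻ y in ball w ρ, F y ∂μ ≤ ∫⁻ y in ball z (2 * ρ), F y ∂μ := h2
    _ = ballAvg μ F z (2 * ρ) * μ (ball z (2 * ρ)) :=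
        (ENNReal.div_mul_cancel (hpos _ _ (by positivity)).ne' (hfin _ _)).symm
    _ ≤ ballAvg μ F z (2 * ρ) * (c ^ 2 * μ (ball w ρ)) := mul_le_mul_right h1 _
    _ = _ := by ring

/-- The record averages at the different scales near `y` sum up to at most a multiple of the
maximal function at `y`. -/
lemma sum_ballSup_isRecord_le {μ : Measure X} {c : ℝ≥0∞} (hdbl : IsDoubling μ c)
    (hpos : ∀ (x : X) (r : ℝ), 0 < r → 0 < μ (ball x r))
    (hfin : ∀ (x : X) (r : ℝ), μ (ball x r) ≠ ∞) {t : ℝ≥0∞} (ht0 : t ≠ 0) (ht1 : t ≤ 1)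
    (F : X → ℝ≥0∞) (E : Set X) {r : ℝ} (hr : 0 < r) (N : ℕ) (y : X) :
    ∑ n ∈ Finset.range N,
      ballSup {z | z ∈ E ∧ IsRecord t (fun m => ballAvg μ F z (2 * (r / 2 ^ m))) n}
        (fun z => ballAvg μ F z (2 * (r / 2 ^ n))) (r / 2 ^ n) y ≤
      (1 + c ^ 2 * (1 - t)⁻¹) * maxFn μ (2 * r) F y := by
  have ht : t ≠ ∞ := ne_top_of_le_ne_top ENNReal.one_ne_top ht1
  have hs0 : ∀ n : ℕ, 0 < r / 2 ^ n := fun n => by positivity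
  have hmax : ∀ (n : ℕ) (z : X), dist y z < r / 2 ^ n →
      ballAvg μ F z (2 * (r / 2 ^ n)) ≤ maxFn μ (2 * r) F y := by
    intro n z hz
    refine ballAvg_le_maxFn (by linarith [hs0 n]) ?_ ?_
    · have : r / 2 ^ n ≤ r := div_le_self hr.le (one_le_pow₀ (by norm_num))
      linarith
    · rw [mem_ball]
      linarith [hs0 n]
  refine sum_range_le_of_decay (fun n => ballSup_le fun z _ hz => hmax n z hz) ?_ N
  intro m n hm hmn hne
  obtain ⟨z, hzS, hz⟩ : ∃ z,
      IsRecord t (fun m => ballAvg μ F z (2 * (r / 2 ^ m))) n ∧ dist y z < r / 2 ^ n := by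
    by_contra! hcon
    refine hne (nonpos_iff_eq_zero.1 (ballSup_le fun z hz hyz => ?_))
    exact absurd hyz (hcon z hz.2).not_gt
  obtain ⟨l, rfl⟩ : ∃ l, m = l + 1 := ⟨m - 1, by omega⟩
  obtain ⟨j, rfl⟩ : ∃ j, n = l + 1 + j := ⟨n - (l + 1), by omega⟩
  have hzl : ballAvg μ F z (2 * (r / 2 ^ l)) ≤ t ^ j * maxFn μ (2 * r) F y := by
    have h := hzS l (by omega)
    have h' : t ^ l * ballAvg μ F z (2 * (r / 2 ^ l)) ≤
        t ^ l * (t ^ (1 + j) * ballAvg μ F z (2 * (r / 2 ^ (l + 1 + j)))) := by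
      rw [← mul_assoc, ← pow_add, ← add_assoc]
      exact h
    refine ((ENNReal.mul_le_mul_iff_right (pow_ne_zero _ ht0) (by finiteness)).1 h').trans ?_
    exact mul_le_mul' (pow_le_pow_right_of_le_one' ht1 (by omega)) (hmax _ z hz)
  refine ballSup_le fun w _ hw => ?_
  have hdist : dist w z ≤ 2 * (r / 2 ^ (l + 1)) := by
    have h1 : r / 2 ^ (l + 1 + j) ≤ r / 2 ^ (l + 1) := by
      exact div_le_div_of_nonneg_left hr.le (by positivity)
        (pow_le_pow_right₀ (by norm_num) (by omega))
    linarith [dist_triangle_left w z y]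
  calc ballAvg μ F w (2 * (r / 2 ^ (l + 1)))
      ≤ c ^ 2 * ballAvg μ F z (2 * (2 * (r / 2 ^ (l + 1)))) :=
        ballAvg_le_mul_ballAvg hdbl hpos hfin F (by linarith [hs0 (l + 1)]) hdist
    _ = c ^ 2 * ballAvg μ F z (2 * (r / 2 ^ l)) := by
        congr 2
        rw [pow_succ]
        field_simp
    _ ≤ c ^ 2 * (t ^ j * maxFn μ (2 * r) F y) := mul_le_mul_right hzl _
    _ = _ := by
        rw [Nat.add_sub_cancel_left, mul_assoc]

lemma lintegral_add_indicator_rpow_le {μ : Measure X} {c : ℝ≥0∞} (hdbl : IsDoubling μ c)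
    (hpos : ∀ (x : X) (r : ℝ), 0 < r → 0 < μ (ball x r))
    (hfin : ∀ (x : X) (r : ℝ), μ (ball x r) ≠ ∞) {p : ℝ} (hp : 1 ≤ p) {f : X → ℝ≥0∞}
    (hf : Measurable f) (x₀ : X) {r : ℝ} (hr : 0 < r) :
    ∫⁻ y, (f y + (ball x₀ (4 * r)).indicator
      (fun _ => ((∫⁻ y, f y ^ p ∂μ) / μ (ball x₀ r)) ^ (1 / p)) y) ^ p ∂μ ≤
      (2 : ℝ≥0∞) ^ (p - 1) * (1 + c ^ 2) * ∫⁻ y, f y ^ p ∂μ := by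
  have hp0 : 0 < p := by linarith
  set I := ∫⁻ y, f y ^ p ∂μ with hI
  have hle : ∀ y, (f y + (ball x₀ (4 * r)).indicator
      (fun _ => (I / μ (ball x₀ r)) ^ (1 / p)) y) ^ p ≤
      (2 : ℝ≥0∞) ^ (p - 1) *
        (f y ^ p + (ball x₀ (4 * r)).indicator (fun _ => I / μ (ball x₀ r)) y) := by
    intro y
    refine (ENNReal.rpow_add_le_mul_rpow_add_rpow _ _ hp).trans
      (mul_le_mul_right (add_le_add_right (le_of_eq ?_) _) _)
    by_cases hy : y ∈ ball x₀ (4 * r)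
    · rw [indicator_of_mem hy, indicator_of_mem hy, ← ENNReal.rpow_mul,
        one_div_mul_cancel hp0.ne', ENNReal.rpow_one]
    · rw [indicator_of_notMem hy, indicator_of_notMem hy, ENNReal.zero_rpow_of_pos hp0]
  refine (lintegral_mono hle).trans ?_
  rw [lintegral_const_mul' _ _ (by finiteness), lintegral_add_left (hf.pow_const p),
    lintegral_indicator_const isOpen_ball.measurableSet, mul_assoc]
  refine mul_le_mul_right ?_ _
  calc I + I / μ (ball x₀ r) * μ (ball x₀ (4 * r))
      ≤ I + I / μ (ball x₀ r) * (c ^ 2 * μ (ball x₀ r)) := by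
        gcongr
        have h := hdbl.measure_ball_pow_mul_le 2 x₀ hr
        norm_num at h
        exact h
    _ = I + c ^ 2 * (I / μ (ball x₀ r) * μ (ball x₀ r)) := by ring
    _ = (1 + c ^ 2) * I := by
        rw [ENNReal.div_mul_cancel (hpos _ _ hr).ne' (hfin _ _)]
        ring

lemma ballAvg_le_of_dist_le {μ : Measure X} {c : ℝ≥0∞}
    (hdbl : IsDoubling μ c) (hpos : ∀ (x : X) (r : ℝ), 0 < r → 0 < μ (ball x r))
    (hfin : ∀ (x : X) (r : ℝ), μ (ball x r) ≠ ∞) {p : ℝ} (hp : 1 < p) {F : X → ℝ≥0∞}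
    (hF : Measurable F) {x₀ z : X} {r : ℝ} (hr : 0 < r) (hz : dist z x₀ ≤ r) (n : ℕ) :
    ballAvg μ F z (2 * (r / 2 ^ n)) ≤
      (c ^ n * (∫⁻ y, F y ^ p ∂μ) / μ (ball x₀ r)) ^ (1 / p) := by
  have hρ : 0 < 2 * (r / 2 ^ n) := by positivity
  refine (ballAvg_le_rpow hF hp (hpos z _ hρ).ne' (hfin _ _)).trans
    (ENNReal.rpow_le_rpow ?_ (by positivity))
  have h : μ (ball x₀ r) ≤ c ^ n * μ (ball z (2 * (r / 2 ^ n))) := by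
    refine (measure_mono (ball_subset_ball' ?_)).trans (hdbl.measure_ball_pow_mul_le n z hρ)
    rw [dist_comm]
    have : (2 : ℝ) ^ n * (2 * (r / 2 ^ n)) = 2 * r := by field_simp
    linarith
  rw [ENNReal.le_div_iff_mul_le (Or.inl (hpos _ _ hr).ne') (Or.inl (hfin _ _))]
  calc (∫⁻ y, F y ^ p ∂μ) / μ (ball z (2 * (r / 2 ^ n))) * μ (ball x₀ r)
      ≤ (∫⁻ y, F y ^ p ∂μ) / μ (ball z (2 * (r / 2 ^ n))) *
          (c ^ n * μ (ball z (2 * (r / 2 ^ n)))) := mul_le_mul_right h _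
    _ = c ^ n * ((∫⁻ y, F y ^ p ∂μ) / μ (ball z (2 * (r / 2 ^ n))) *
          μ (ball z (2 * (r / 2 ^ n)))) := by ring
    _ = _ := by rw [ENNReal.div_mul_cancel (hpos _ _ hρ).ne' (hfin _ _)]

lemma ofReal_div_two_pow_rpow {r : ℝ} (hr : 0 < r) (β : ℝ) (n : ℕ) :
    ENNReal.ofReal ((r / 2 ^ n) ^ β) = ENNReal.ofReal (r ^ β) *
      (((2 : ℝ≥0∞) ^ (-(β / 2))) ^ n * ((2 : ℝ≥0∞) ^ (-(β / 2))) ^ n) := by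
  have h2 : (2 : ℝ≥0∞) ^ (-(β / 2)) * (2 : ℝ≥0∞) ^ (-(β / 2)) =
      ENNReal.ofReal ((2 : ℝ) ^ (-β)) := by
    rw [← ENNReal.rpow_add _ _ (by norm_num) (by norm_num),
      ← ENNReal.ofReal_rpow_of_pos (by norm_num)]
    congr 1
    · norm_num
    · ring
  rw [← mul_pow, h2, ← ENNReal.ofReal_pow (by positivity), ← ENNReal.ofReal_mul (by positivity),
    Real.div_rpow hr.le (by positivity), Real.rpow_neg (by norm_num), inv_pow,
    Real.rpow_pow_comm (by norm_num), div_eq_mul_inv]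

lemma exists_relCap_le_lintegral {μ : Measure X} [Nontrivial X] {c cσ : ℝ≥0∞} (hc : c ≠ ∞)
    (hc0 : c ≠ 0) (hdbl : IsDoubling μ c) (hpos : ∀ (x : X) (r : ℝ), 0 < r → 0 < μ (ball x r))
    (hfin : ∀ (x : X) (r : ℝ), μ (ball x r) ≠ ∞) {p β σ : ℝ} {q : ℝ≥0∞} (hp : 1 < p)
    (hq : 1 ≤ q) (hβ0 : 0 < β) (hβ1 : β < 1) (hσ : β * p < σ) (hcσ : cσ ≠ ∞)
    (hqrd : IsQRD μ σ cσ) (Λ : ℝ) :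
    ∃ C : ℝ≥0∞, C ≠ ∞ ∧ ∀ (x₀ : X) (r : ℝ), 0 < r → ∀ E : Set X, IsCompact E →
      E ⊆ closedBall x₀ r → ∀ f : X → ℝ≥0∞, Measurable f → ∫⁻ x, f x ^ p ∂μ ≠ ∞ →
        (∀ x ∈ E, 1 ≤ rieszPot μ (μ.withDensity f) β x) →
          relCap μ β p q E x₀ r Λ ≤ C * ∫⁻ x, f x ^ p ∂μ := by
  have hp0 : 0 < p := by linarith
  obtain ⟨C₁, hC₁, hriesz⟩ := exists_rieszPot_le hc hc0 hdbl hpos hfin hp hβ0 hσ hcσ hqrd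
  obtain ⟨C₂, hC₂, hmax⟩ := exists_lintegral_maxFn_rpow_le hc hdbl hpos hfin hp
  obtain ⟨C₃, hC₃, hscale⟩ := exists_tsum_scale_le hβ0 hβ1
  set t : ℝ≥0∞ := (2 : ℝ≥0∞) ^ (-(β / 2)) with ht
  have ht1 : t < 1 := two_rpow_neg_lt_one (by positivity)
  have ht0 : t ≠ 0 := (ENNReal.rpow_pos (by norm_num) (by norm_num)).ne'
  have ht' : t ≠ ∞ := ne_top_of_lt ht1
  have hT : (1 - t)⁻¹ ≠ ∞ := ENNReal.inv_ne_top.2 (tsub_pos_of_lt ht1).ne'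
  set K : ℝ≥0∞ := 2 * C₁ * (1 - t)⁻¹ with hK
  have hKtop : K ≠ ∞ := by finiteness
  set A : ℝ≥0∞ := K * C₃ * (1 + c ^ 2 * (1 - t)⁻¹) with hA
  have hAtop : A ≠ ∞ := by finiteness
  refine ⟨A ^ p * (C₂ * ((2 : ℝ≥0∞) ^ (p - 1) * (1 + c ^ 2))), by finiteness, ?_⟩
  intro x₀ r hr E hE hEr f hf hI hadm
  set F : X → ℝ≥0∞ := fun y => f y + (ball x₀ (4 * r)).indicator
    (fun _ => ((∫⁻ y, f y ^ p ∂μ) / μ (ball x₀ r)) ^ (1 / p)) y with hF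
  have hFm : Measurable F := hf.add (measurable_const.indicator isOpen_ball.measurableSet)
  have hFI : ∫⁻ y, F y ^ p ∂μ ≤ (2 : ℝ≥0∞) ^ (p - 1) * (1 + c ^ 2) * ∫⁻ y, f y ^ p ∂μ :=
    lintegral_add_indicator_rpow_le hdbl hpos hfin hp.le hf x₀ hr
  have hFtop : ∫⁻ y, F y ^ p ∂μ ≠ ∞ := ne_top_of_le_ne_top (by finiteness) hFI
  set a : ℕ → X → ℝ≥0∞ := fun n z => ballAvg μ F z (2 * (r / 2 ^ n)) with ha
  set S : ℕ → Set X := fun n => {z | z ∈ E ∧ IsRecord t (fun m => a m z) n} with hS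
  obtain ⟨N, hN⟩ := exists_relCap_le_lintegral_sum (μ := μ) hp0 hβ0 hq Λ hE hEr (S := S)
    (fun n z hz => hz.1) (a := a) (s := fun n => r / 2 ^ n) (fun n => by positivity)
    (fun n => div_le_self hr.le (one_le_pow₀ (by norm_num)))
    (Q := fun n => (c ^ n * (∫⁻ y, F y ^ p ∂μ) / μ (ball x₀ r)) ^ (1 / p))
    (W := fun n => K * ENNReal.ofReal (r ^ β) * (t ^ n * t ^ n))
    (fun n => ENNReal.rpow_ne_top_of_nonneg (by positivity)
      (ENNReal.div_ne_top (by finiteness) (hpos _ _ hr).ne'))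
    (fun n => by finiteness)
    (fun n z hz => ballAvg_le_of_dist_le hdbl hpos hfin hp hFm hr (hEr hz.1) n) (by
      intro x hx
      calc (1 : ℝ≥0∞) < 2 * 1 := by norm_num
        _ ≤ 2 * (C₁ * (ENNReal.ofReal (r ^ β) * ∑' n : ℕ, t ^ n * t ^ n * a n x)) :=
            mul_le_mul_right ((hadm x hx).trans (hriesz f hf x x₀ r hr (hEr hx))) _
        _ ≤ 2 * (C₁ * (ENNReal.ofReal (r ^ β) * ((1 - t)⁻¹ *
              ∑' n : ℕ, t ^ n * t ^ n * bumpSup (S n) (a n) (r / 2 ^ n) x))) := by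
            refine mul_le_mul_right (mul_le_mul_right (mul_le_mul_right
              ((tsum_le_tsum_isRecord t _).trans (mul_le_mul_right
                (ENNReal.tsum_le_tsum fun n => ?_) _)) _) _) _
            split_ifs with h
            · exact mul_le_mul_right (le_bumpSup (S := S n) ⟨hx, h⟩) _
            · exact zero_le
        _ = ∑' n, K * ENNReal.ofReal (r ^ β) * (t ^ n * t ^ n) *
              bumpSup (S n) (a n) (r / 2 ^ n) x := by
            simp_rw [mul_assoc (K * ENNReal.ofReal (r ^ β)), ENNReal.tsum_mul_left]
            ring)
  refine hN.trans ?_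
  calc _ ≤ ∫⁻ x, A ^ p * maxFn μ (2 * r) F x ^ p ∂μ := by
        refine lintegral_mono fun x => ?_
        rw [← ENNReal.mul_rpow_of_nonneg _ _ hp0.le]
        refine ENNReal.rpow_le_rpow ?_ hp0.le
        calc _ ≤ ∑ n ∈ Finset.range N, K * C₃ * ballSup (S n) (a n) (r / 2 ^ n) x := by
              refine Finset.sum_le_sum fun n _ => mul_le_mul_left ?_ _
              rw [mul_assoc K, ← ofReal_div_two_pow_rpow hr, mul_assoc, ← ENNReal.tsum_mul_left]
              exact mul_le_mul_right (hscale _ (by positivity)) _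
          _ ≤ K * C₃ * ((1 + c ^ 2 * (1 - t)⁻¹) * maxFn μ (2 * r) F x) := by
              rw [← Finset.mul_sum]
              exact mul_le_mul_right
                (sum_ballSup_isRecord_le hdbl hpos hfin ht0 ht1.le F E hr N x) _
          _ = _ := by ring
    _ = A ^ p * ∫⁻ x, maxFn μ (2 * r) F x ^ p ∂μ :=
        lintegral_const_mul _ ((measurable_maxFn μ _ F).pow_const p)
    _ ≤ A ^ p * (C₂ * ((2 : ℝ≥0∞) ^ (p - 1) * (1 + c ^ 2) * ∫⁻ y, f y ^ p ∂μ)) :=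
        mul_le_mul_right ((hmax _ F hFm).trans (mul_le_mul_right hFI _)) _
    _ = _ := by ring

theorem statement18
    (μ : Measure X) [Nontrivial X]
    (c_mu : ℝ≥0∞) (hc1 : 1 < c_mu) (hc2 : c_mu ≠ ∞) (hdbl : IsDoubling μ c_mu)
    (hpos : ∀ (x : X) (r : ℝ), 0 < r → 0 < μ (ball x r))
    (hfin : ∀ (x : X) (r : ℝ), μ (ball x r) ≠ ∞)
    (c_sigma : ℝ≥0∞) (p β σ Λ : ℝ) (q : ℝ≥0∞)
    (hp : 1 < p) (hq : 1 < q) (hβ0 : 0 < β) (hβ1 : β < 1) (hΛ : 2 ≤ Λ)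
    (hσ : β * p < σ) (hcσ0 : 0 < c_sigma) (hcσ1 : c_sigma ≠ ∞) (hqrd : IsQRD μ σ c_sigma) :
    ∃ C : ℝ≥0∞, 0 < C ∧ C ≠ ∞ ∧
      ∀ (x₀ : X) (r : ℝ), 0 < r →
        ∀ E : Set X, IsCompact E → E ⊆ closure (ball x₀ r) →
          relCap μ β p q E x₀ r Λ ≤ C * rieszCap μ β p E := by
  have hc0 : c_mu ≠ 0 := (zero_lt_one.trans hc1).ne'
  obtain ⟨C, hC, h⟩ := exists_relCap_le_lintegral hc2 hc0 hdbl hpos hfin hp hq.le hβ0 hβ1 hσ hcσ1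
    hqrd Λ
  refine ⟨C + 1, by positivity, by finiteness, fun x₀ r hr E hE hEr => ?_⟩
  rw [rieszCap, ENNReal.mul_iInf_of_ne (by positivity) (by finiteness)]
  refine le_iInf fun f => ?_
  rcases eq_or_ne (∫⁻ x, f.1 x ^ p ∂μ) ∞ with hI | hI
  · rw [hI, ENNReal.mul_top (by positivity)]
    exact le_top
  · exact (h x₀ r hr E hE (hEr.trans closure_ball_subset_closedBall) f.1 f.2.1 hI f.2.2).trans
      (mul_le_mul_left le_self_add _)

end TLCap

end
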